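/- arXiv:2301.04610 — 15 statements merged into one kernel-verified Lean document; each statement's English description precedes it below -/
import Mathlib

section
/- Let H₀ be a complex Hilbert space, D ⊆ H₀ a dense linear subspace, and N : D → ℝ a norm on D (not assumed comparable to the norm of H₀). For g ∈ H₀ set ‖g‖₋ := sup{ |⟨g,f⟩_{H₀}| / N(f) : f ∈ D, f ≠ 0 } and D₋ := { g ∈ H₀ : ‖g‖₋ < +∞ }. Then D₋ is complete with respect to the norm g ↦ √(‖g‖_{H₀}² + ‖g‖₋²), i.e., every Cauchy sequence in D₋ for this norm converges to an element of D₋ in this norm. -/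
open scoped InnerProductSpace

/-- Let `H₀` be a complex Hilbert space, `D ⊆ H₀` a dense linear subspace and
`N` a norm on `D` (unrelated to the norm of `H₀`).  For `g ∈ H₀` let
`‖g‖₋ = sup { |⟨g,f⟩| / N f : f ∈ D, f ≠ 0 }` and let `D₋` be the set of `g` for which this
supremum is finite.  Then `D₋` is complete with respect to the norm
`g ↦ √(‖g‖_{H₀}² + ‖g‖₋²)`. -/
theorem stmt0 {H0 : Type*} [NormedAddCommGroup H0] [InnerProductSpace ℂ H0] [CompleteSpace H0]
    (D : Submodule ℂ H0) (hD : Dense (D : Set H0))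
    (N : D → ℝ)
    (hN0 : ∀ f : D, N f = 0 ↔ f = 0)
    (hNadd : ∀ f g : D, N (f + g) ≤ N f + N g)
    (hNsmul : ∀ (c : ℂ) (f : D), N (c • f) = ‖c‖ * N f)
    (Dm : Set H0)
    (hDm : Dm = {g : H0 |
      BddAbove (Set.range fun f : {f : D // f ≠ 0} => ‖(⟪((f : D) : H0), g⟫_ℂ)‖ / N f)})
    (nm : H0 → ℝ)
    (hnm : ∀ g : H0, nm g =
      sSup (Set.range fun f : {f : D // f ≠ 0} => ‖(⟪((f : D) : H0), g⟫_ℂ)‖ / N f))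
    (g : ℕ → H0) (hg : ∀ n, g n ∈ Dm)
    (hcauchy : ∀ ε > (0 : ℝ), ∃ n₀ : ℕ, ∀ n ≥ n₀, ∀ m ≥ n₀,
      Real.sqrt (‖g n - g m‖ ^ 2 + nm (g n - g m) ^ 2) < ε) :
    ∃ g₀ ∈ Dm, ∀ ε > (0 : ℝ), ∃ n₀ : ℕ, ∀ n ≥ n₀,
      Real.sqrt (‖g n - g₀‖ ^ 2 + nm (g n - g₀) ^ 2) < ε := by
  have hNnn : ∀ f : D, 0 ≤ N f := fun f ↦ by
    have h := hNadd f ((-1 : ℂ) • f)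
    have h0 : f + (-1 : ℂ) • f = 0 := by simp
    rw [h0, (hN0 0).2 rfl, hNsmul] at h
    simp only [norm_neg, norm_one, one_mul] at h
    linarith
  have hsub : ∀ a b : H0, a ∈ Dm → b ∈ Dm → a - b ∈ Dm := by
    subst hDm
    rintro a b ⟨A, hA⟩ ⟨B, hB⟩
    refine ⟨A + B, ?_⟩
    rintro _ ⟨f, rfl⟩
    calc ‖⟪((f : D) : H0), a - b⟫_ℂ‖ / N f
        ≤ (‖⟪((f : D) : H0), a⟫_ℂ‖ + ‖⟪((f : D) : H0), b⟫_ℂ‖) / N f := by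
          rw [inner_sub_right]
          exact div_le_div_of_nonneg_right (norm_sub_le _ _) (hNnn f)
      _ ≤ A + B := by
          rw [add_div]
          exact add_le_add (hA ⟨f, rfl⟩) (hB ⟨f, rfl⟩)
  have hle : ∀ h ∈ Dm, ∀ f : {f : D // f ≠ 0}, ‖⟪((f : D) : H0), h⟫_ℂ‖ / N f ≤ nm h := by
    subst hDm
    intro h hh f
    rw [hnm]
    exact le_csSup hh ⟨f, rfl⟩
  have hnorm : ∀ ε > (0 : ℝ), ∃ n₀ : ℕ, ∀ n ≥ n₀, ∀ m ≥ n₀,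
      ‖g n - g m‖ < ε ∧ nm (g n - g m) < ε := by
    intro ε hε
    obtain ⟨n₀, h⟩ := hcauchy ε hε
    refine ⟨n₀, fun n hn m hm ↦ ⟨lt_of_le_of_lt ?_ (h n hn m hm), lt_of_le_of_lt ?_ (h n hn m hm)⟩⟩
    · exact Real.le_sqrt_of_sq_le (le_add_of_nonneg_right (sq_nonneg _))
    · exact Real.le_sqrt_of_sq_le (le_add_of_nonneg_left (sq_nonneg _))
  have hcs : CauchySeq g := Metric.cauchySeq_iff.2 fun ε hε ↦ by
    obtain ⟨n₀, h⟩ := hnorm ε hε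
    exact ⟨n₀, fun n hn m hm ↦ by simpa [dist_eq_norm] using (h n hn m hm).1⟩
  obtain ⟨g₀, hg₀⟩ := cauchySeq_tendsto_of_complete hcs
  have hlim : ∀ ε > (0 : ℝ), ∃ n₀ : ℕ, ∀ n ≥ n₀, ‖g n - g₀‖ ≤ ε ∧
      ∀ f : {f : D // f ≠ 0}, ‖⟪((f : D) : H0), g n - g₀⟫_ℂ‖ / N f ≤ ε := by
    intro ε hε
    obtain ⟨n₀, h⟩ := hnorm ε hε
    refine ⟨n₀, fun n hn ↦ ?_⟩
    have ht : Filter.Tendsto (fun m ↦ g n - g m) Filter.atTop (nhds (g n - g₀)) :=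
      tendsto_const_nhds.sub hg₀
    refine ⟨le_of_tendsto ht.norm ?_, fun f ↦
      le_of_tendsto (((tendsto_const_nhds (x := ((f : D) : H0))).inner ht).norm.div_const _) ?_⟩
    · filter_upwards [Filter.eventually_ge_atTop n₀] with m hm using (h n hn m hm).1.le
    · filter_upwards [Filter.eventually_ge_atTop n₀] with m hm
      exact (hle _ (hsub _ _ (hg n) (hg m)) f).trans (h n hn m hm).2.le
  refine ⟨g₀, ?_, fun ε hε ↦ ?_⟩
  · obtain ⟨n₀, h⟩ := hlim 1 one_pos
    have hmem : g n₀ - g₀ ∈ Dm := by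
      rw [hDm]
      exact ⟨1, by rintro _ ⟨f, rfl⟩; exact (h n₀ le_rfl).2 f⟩
    simpa using hsub _ _ (hg n₀) hmem
  · obtain ⟨n₀, h⟩ := hlim (ε / 2) (half_pos hε)
    refine ⟨n₀, fun n hn ↦ ?_⟩
    obtain ⟨h₁, h₂⟩ := h n hn
    have hnm_le : nm (g n - g₀) ≤ ε / 2 := by
      rw [hnm]
      exact Real.sSup_le (by rintro _ ⟨f, rfl⟩; exact h₂ f) (half_pos hε).le
    have hnm_nonneg : 0 ≤ nm (g n - g₀) := by
      rw [hnm]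
      exact Real.sSup_nonneg (by rintro _ ⟨f, rfl⟩; exact div_nonneg (norm_nonneg _) (hNnn f))
    rw [Real.sqrt_lt' hε]
    nlinarith [pow_le_pow_left₀ (norm_nonneg _) h₁ 2, pow_le_pow_left₀ hnm_nonneg hnm_le 2]
end

section
/- Let H₊ and H₀ be complex Hilbert spaces and ι : dom ι ⊆ H₊ → H₀ a densely defined linear operator with dense range. The following are equivalent: (a) ι is closable and its closure is injective; (b) there exist a Hausdorff topological vector space Z over ℂ and injective continuous linear maps φ₊ : H₊ → Z and φ₀ : H₀ → Z such that φ₊ f = φ₀ (ι f) for all f ∈ dom ι. -/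
open scoped InnerProductSpace

/-- For a densely defined linear operator `ι : dom ι ⊆ H₊ → H₀` with dense range
between complex Hilbert spaces, the following are equivalent:
(a) `ι` is closable and its closure is injective;
(b) there is a Hausdorff topological vector space `Z` over `ℂ` and injective continuous linear
maps `φ₊ : H₊ → Z`, `φ₀ : H₀ → Z` with `φ₊ f = φ₀ (ι f)` for all `f ∈ dom ι`. -/
theorem stmt2 {Hp : Type u} {H0 : Type v}
    [NormedAddCommGroup Hp] [InnerProductSpace ℂ Hp] [CompleteSpace Hp]
    [NormedAddCommGroup H0] [InnerProductSpace ℂ H0] [CompleteSpace H0]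
    (ι : Hp →ₗ.[ℂ] H0)
    (hdom : Dense (ι.domain : Set Hp))
    (hran : Dense (Set.range fun f : ι.domain => ι f)) :
    (ι.IsClosable ∧
        ∀ x y : ι.closure.domain, ι.closure x = ι.closure y → (x : Hp) = (y : Hp)) ↔
      ∃ (Z : Type (max u v)) (_ : AddCommGroup Z) (_ : Module ℂ Z) (_ : TopologicalSpace Z)
        (_ : T2Space Z) (_ : ContinuousAdd Z) (_ : ContinuousSMul ℂ Z)
        (φp : Hp →L[ℂ] Z) (φ0 : H0 →L[ℂ] Z),
        Function.Injective φp ∧ Function.Injective φ0 ∧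
          ∀ f : ι.domain, φp (f : Hp) = φ0 (ι f) := by
  constructor
  · rintro ⟨hc, hinj⟩
    have hcl : IsClosed (ι.closure.graph : Set (Hp × H0)) := hc.closure_isClosed
    refine ⟨(Hp × H0) ⧸ ι.closure.graph, inferInstance, inferInstance, inferInstance,
      inferInstance, inferInstance, inferInstance,
      ι.closure.graph.mkQL.comp (ContinuousLinearMap.inl ℂ Hp H0),
      -(ι.closure.graph.mkQL.comp (ContinuousLinearMap.inr ℂ Hp H0)), ?_, ?_, ?_⟩
    · refine (injective_iff_map_eq_zero _).2 fun x hx => ?_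
      have hx' : (x, (0 : H0)) ∈ ι.closure.graph := (Submodule.Quotient.mk_eq_zero _).1 hx
      obtain ⟨z, hz, hz0⟩ := (LinearPMap.mem_graph_iff _).1 hx'
      have := hinj z 0 (by rw [LinearPMap.map_zero]; exact hz0)
      exact hz.symm.trans this
    · refine (injective_iff_map_eq_zero _).2 fun y hy => ?_
      have hy' : ((0 : Hp), y) ∈ ι.closure.graph :=
        (Submodule.Quotient.mk_eq_zero _).1 (neg_eq_zero.1 hy)
      exact ι.closure.graph_fst_eq_zero_snd hy' rfl
    · intro f
      have hf : ((f : Hp), ι f) ∈ ι.closure.graph :=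
        LinearPMap.le_graph_of_le ι.le_closure (ι.mem_graph f)
      have h0 : ι.closure.graph.mkQL ((f : Hp), ι f) = 0 :=
        (Submodule.Quotient.mk_eq_zero _).2 hf
      have hs : ((f : Hp), ι f) = ((f : Hp), 0) + (0, ι f) := by simp
      rw [hs, map_add] at h0
      exact eq_neg_of_add_eq_zero_left h0
  · rintro ⟨Z, _, _, _, _, _, _, φp, φ0, hp, h0, h⟩
    have hK : ∀ q ∈ ι.graph.topologicalClosure, φp q.1 = φ0 q.2 := by
      intro q hq
      have hcl : IsClosed {q : Hp × H0 | φp q.1 = φ0 q.2} :=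
        isClosed_eq (φp.continuous.comp continuous_fst) (φ0.continuous.comp continuous_snd)
      refine closure_minimal ?_ hcl hq
      intro q hq
      obtain ⟨z, hz, hz'⟩ := (LinearPMap.mem_graph_iff _).1 hq
      rw [Set.mem_ofPred_eq, ← hz, ← hz', h]
    have hc : ι.IsClosable := by
      refine ⟨ι.graph.topologicalClosure.toLinearPMap,
        (Submodule.toLinearPMap_graph_eq _ fun q hq hq0 => ?_).symm⟩
      have := hK q hq
      rw [hq0, map_zero] at this
      exact (injective_iff_map_eq_zero φ0).1 h0 _ this.symm
    refine ⟨hc, fun x y hxy => hp ?_⟩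
    have hmem : ∀ z : ι.closure.domain, φp z = φ0 (ι.closure z) := fun z =>
      hK (z, ι.closure z) (hc.graph_closure_eq_closure_graph ▸ ι.closure.mem_graph z)
    rw [hmem, hmem, hxy]
end

section
/- For a pre-quasi Gelfand triple of Hilbert spaces (H₊, H₀, H₋) with embeddings ι₊, ι₋, one has dom ι₊ᴴ = ran ι₋ if and only if dom ι₋ᴴ = ran ι₊. -/
open scoped InnerProductSpace LinearPMap

/-- A pair satisfying the adjoint relation against all of `T†` lies in the graph of `T`, when `T` is
closed and densely defined: the inclusion `T†† ≤ T`. -/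
theorem LinearPMap.IsClosed.mem_graph_of_inner_adjoint {𝕜 E F : Type*} [RCLike 𝕜]
    [NormedAddCommGroup E] [InnerProductSpace 𝕜 E] [CompleteSpace E]
    [NormedAddCommGroup F] [InnerProductSpace 𝕜 F] [CompleteSpace F]
    {T : E →ₗ.[𝕜] F} (hT : T.IsClosed) (hd : Dense (T.domain : Set E)) {u : E} {y : F}
    (h : ∀ b : (T†).domain, inner 𝕜 (T† b) u = inner 𝕜 (b : F) y) :
    (u, y) ∈ T.graph := by
  let K : Submodule 𝕜 (WithLp 2 (E × F)) :=
    T.graph.comap (WithLp.linearEquiv 2 𝕜 (E × F)).toLinearMap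
  have hK : _root_.IsClosed (K : Set (WithLp 2 (E × F))) :=
    IsClosed.preimage (WithLp.prod_continuous_ofLp 2 E F) hT
  suffices WithLp.toLp 2 (u, y) ∈ K from this
  rw [← hK.submodule_topologicalClosure_eq, ← K.orthogonal_orthogonal_eq_closure,
    Submodule.mem_orthogonal]
  intro v hv
  have hv' (x : T.domain) : inner 𝕜 (-v.fst) (x : E) = inner 𝕜 v.snd (T x) := by
    have := (Submodule.mem_orthogonal' K v).1 hv (WithLp.toLp 2 ((x : E), T x)) (T.mem_graph x)
    rw [WithLp.prod_inner_apply] at this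
    rw [inner_neg_left]
    exact neg_eq_of_add_eq_zero_right this
  have hb : v.snd ∈ (T†).domain := T.mem_adjoint_domain_of_exists _ ⟨_, hv'⟩
  have := h ⟨v.snd, hb⟩
  rw [LinearPMap.adjoint_apply_eq hd ⟨v.snd, hb⟩ hv', inner_neg_left] at this
  rw [WithLp.prod_inner_apply]
  exact (neg_eq_iff_add_eq_zero.1 this)

/-- For densely defined operators into a common space that are dual to each other through a unitary
map, with `S` closed, if `dom S†` is the range of `T` then `dom T†` is the range of `S`. -/
theorem LinearPMap.adjoint_domain_eq_range_of_adjoint_domain_eq_range {𝕜 E F G : Type*} [RCLike 𝕜]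
    [NormedAddCommGroup E] [InnerProductSpace 𝕜 E] [CompleteSpace E]
    [NormedAddCommGroup F] [InnerProductSpace 𝕜 F] [CompleteSpace F]
    [NormedAddCommGroup G] [InnerProductSpace 𝕜 G] [CompleteSpace G]
    (Ψ : G ≃ₗᵢ[𝕜] E) {S : E →ₗ.[𝕜] F} {T : G →ₗ.[𝕜] F}
    (hS : Dense (S.domain : Set E)) (hT : Dense (T.domain : Set G)) (hSc : S.IsClosed)
    (hST : ∀ (f : S.domain) (g : T.domain),
      inner 𝕜 (S f) (T g) = inner 𝕜 (f : E) (Ψ (g : G)))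
    (h : ((S†).domain : Set F) = Set.range fun g : T.domain => T g) :
    ((T†).domain : Set F) = Set.range fun f : S.domain => S f := by
  apply Set.Subset.antisymm
  · intro y hy
    have hmem : (Ψ (T† ⟨y, hy⟩), y) ∈ S.graph := by
      refine hSc.mem_graph_of_inner_adjoint hS fun ⟨b, hb⟩ => ?_
      obtain ⟨g, rfl⟩ : b ∈ Set.range fun g : T.domain => T g := h ▸ hb
      have hΨ : S† ⟨T g, hb⟩ = Ψ g := LinearPMap.adjoint_apply_eq hS _ fun x => by
        rw [← inner_conj_symm, ← hST, inner_conj_symm]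
      rw [hΨ, LinearIsometryEquiv.inner_map_map]
      exact (LinearPMap.adjoint_isFormalAdjoint hT).symm g ⟨y, hy⟩ |>.symm
    obtain ⟨f, -, hf⟩ := (LinearPMap.mem_graph_iff S).1 hmem
    exact ⟨f, hf⟩
  · rintro _ ⟨f, rfl⟩
    refine T.mem_adjoint_domain_of_exists _ ⟨Ψ.symm f, fun g => ?_⟩
    rw [hST, ← Ψ.inner_map_map, Ψ.apply_symm_apply]

/-- For a pre-quasi Gelfand triple of Hilbert spaces `(H₊, H₀, H₋)` with
embeddings `ι₊`, `ι₋` (and unitary `Ψ : H₋ → H₊` encoding the duality), one has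
`dom ι₊ᴴ = ran ι₋` if and only if `dom ι₋ᴴ = ran ι₊`. -/
theorem stmt4 {Hp H0 Hm : Type*}
    [NormedAddCommGroup Hp] [InnerProductSpace ℂ Hp] [CompleteSpace Hp]
    [NormedAddCommGroup H0] [InnerProductSpace ℂ H0] [CompleteSpace H0]
    [NormedAddCommGroup Hm] [InnerProductSpace ℂ Hm] [CompleteSpace Hm]
    (Ψ : Hm ≃ₗᵢ[ℂ] Hp)
    (ιp : Hp →ₗ.[ℂ] H0) (ιm : Hm →ₗ.[ℂ] H0)
    (hpDense : Dense (ιp.domain : Set Hp))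
    (hmDense : Dense (ιm.domain : Set Hm))
    (hpClosed : ιp.IsClosed) (hmClosed : ιm.IsClosed)
    (hpInj : ∀ x y : ιp.domain, ιp x = ιp y → (x : Hp) = (y : Hp))
    (hmInj : ∀ x y : ιm.domain, ιm x = ιm y → (x : Hm) = (y : Hm))
    (hpRan : Dense (Set.range fun f : ιp.domain => ιp f))
    (hmRan : Dense (Set.range fun g : ιm.domain => ιm g))
    (compat : ∀ (f : ιp.domain) (g : ιm.domain),
      (⟪ιp f, ιm g⟫_ℂ) = ⟪(f : Hp), Ψ (g : Hm)⟫_ℂ)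
    :
    (((ιp†).domain : Set H0) = Set.range fun g : ιm.domain => ιm g) ↔
      (((ιm†).domain : Set H0) = Set.range fun f : ιp.domain => ιp f) := by
  refine ⟨LinearPMap.adjoint_domain_eq_range_of_adjoint_domain_eq_range Ψ hpDense hmDense hpClosed
    compat, LinearPMap.adjoint_domain_eq_range_of_adjoint_domain_eq_range Ψ.symm hmDense hpDense
    hmClosed fun g f => ?_⟩
  rw [← inner_conj_symm, compat, inner_conj_symm, ← Ψ.inner_map_map, Ψ.apply_symm_apply]
end

section
/- Let (H₊, H₀, H₋) be a pre-quasi Gelfand triple of Hilbert spaces with embeddings ι₊, ι₋ and unitary Ψ. Then there exists a densely defined, closed, injective linear operator ι̂₋ : dom ι̂₋ ⊆ H₋ → H₀ with dense range which extends ι₋ (dom ι₋ ⊆ dom ι̂₋ and ι̂₋ g = ι₋ g for g ∈ dom ι₋), satisfies ⟨ι̂₋ g, ι₊ f⟩_{H₀} = ⟨Ψ g, f⟩_{H₊} for all f ∈ dom ι₊ and g ∈ dom ι̂₋, and satisfies ran ι̂₋ = dom ι₊ᴴ; in particular (H₊, H₀, H₋) with ι₊ and ι̂₋ is a quasi Gelfand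 triple. -/
open scoped InnerProductSpace LinearPMap

/-- The pairs `(g, h)` with `⟪T f, h⟫ = ⟪f, Ψ g⟫` for all `f` in the domain of `T`: the graph of
the inverse of `Ψ⁻¹ ∘ T†`. -/
def LinearPMap.dualGraph {E F G : Type*}
    [NormedAddCommGroup E] [InnerProductSpace ℂ E] [NormedAddCommGroup F] [InnerProductSpace ℂ F]
    [NormedAddCommGroup G] [InnerProductSpace ℂ G]
    (T : E →ₗ.[ℂ] F) (Ψ : G ≃ₗᵢ[ℂ] E) : Submodule ℂ (G × F) where
  carrier := {p | ∀ f : T.domain, ⟪T f, p.2⟫_ℂ = ⟪(f : E), Ψ p.1⟫_ℂ}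
  zero_mem' f := by simp
  add_mem' {a b} ha hb f := by
    simp only [Prod.snd_add, Prod.fst_add, LinearIsometryEquiv.map_add, inner_add_right, ha f, hb f]
  smul_mem' c a ha f := by
    simp only [Prod.smul_snd, Prod.smul_fst, LinearIsometryEquiv.map_smul, inner_smul_right,
      ha f]

namespace LinearPMap

variable {E F G : Type*}
  [NormedAddCommGroup E] [InnerProductSpace ℂ E] [NormedAddCommGroup F] [InnerProductSpace ℂ F]
  [NormedAddCommGroup G] [InnerProductSpace ℂ G] {T : E →ₗ.[ℂ] F} {Ψ : G ≃ₗᵢ[ℂ] E}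

theorem mem_dualGraph_iff {p : G × F} :
    p ∈ T.dualGraph Ψ ↔ ∀ f : T.domain, ⟪T f, p.2⟫_ℂ = ⟪(f : E), Ψ p.1⟫_ℂ :=
  Iff.rfl

theorem isClosed_dualGraph : _root_.IsClosed (T.dualGraph Ψ : Set (G × F)) := by
  have h : (T.dualGraph Ψ : Set (G × F)) =
      ⋂ f : T.domain, {p | ⟪T f, p.2⟫_ℂ = ⟪(f : E), Ψ p.1⟫_ℂ} := by
    ext p
    simp [mem_dualGraph_iff]
  rw [h]
  exact isClosed_iInter fun f => isClosed_eq (by fun_prop) (by fun_prop)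

theorem snd_eq_zero_of_mem_dualGraph (hT : Dense (Set.range fun f : T.domain => T f))
    {p : G × F} (hp : p ∈ T.dualGraph Ψ) (h : p.1 = 0) : p.2 = 0 := by
  refine hT.eq_zero_of_inner_right ℂ ?_
  rintro _ ⟨f, rfl⟩
  simpa [h] using mem_dualGraph_iff.1 hp f

theorem fst_eq_zero_of_mem_dualGraph (hT : Dense (T.domain : Set E))
    {p : G × F} (hp : p ∈ T.dualGraph Ψ) (h : p.2 = 0) : p.1 = 0 := by
  have hΨ : Ψ p.1 = 0 := hT.eq_zero_of_inner_right ℂ fun f hf => by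
    simpa [h] using (mem_dualGraph_iff.1 hp ⟨f, hf⟩).symm
  simpa using hΨ

theorem mem_adjoint_domain_iff_exists_mem_dualGraph [CompleteSpace E]
    (hT : Dense (T.domain : Set E)) {h : F} :
    h ∈ T†.domain ↔ ∃ g : G, (g, h) ∈ T.dualGraph Ψ := by
  constructor
  · intro hh
    refine ⟨Ψ.symm (T† ⟨h, hh⟩), fun f => ?_⟩
    simpa using (adjoint_isFormalAdjoint hT).symm f ⟨h, hh⟩
  · rintro ⟨g, hg⟩
    refine mem_adjoint_domain_of_exists h ⟨Ψ g, fun f => ?_⟩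
    rw [← inner_conj_symm, ← inner_conj_symm h, mem_dualGraph_iff.1 hg f]

end LinearPMap

/-- Every pre-quasi Gelfand triple `(H₊, H₀, H₋)` with embeddings `ι₊`, `ι₋` and
unitary `Ψ` admits a densely defined, closed, injective extension `ι̂₋` of `ι₋` with dense range
which still satisfies the compatibility relation `⟨ι̂₋ g, ι₊ f⟩_{H₀} = ⟨Ψ g, f⟩_{H₊}` and
moreover `ran ι̂₋ = dom ι₊ᴴ`; in particular `(H₊, H₀, H₋)` with `ι₊` and `ι̂₋` is a quasi
Gelfand triple. -/
theorem stmt5 {Hp H0 Hm : Type*}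
    [NormedAddCommGroup Hp] [InnerProductSpace ℂ Hp] [CompleteSpace Hp]
    [NormedAddCommGroup H0] [InnerProductSpace ℂ H0] [CompleteSpace H0]
    [NormedAddCommGroup Hm] [InnerProductSpace ℂ Hm] [CompleteSpace Hm]
    (Ψ : Hm ≃ₗᵢ[ℂ] Hp)
    (ιp : Hp →ₗ.[ℂ] H0) (ιm : Hm →ₗ.[ℂ] H0)
    (hpDense : Dense (ιp.domain : Set Hp))
    (hmDense : Dense (ιm.domain : Set Hm))
    (hpClosed : ιp.IsClosed) (hmClosed : ιm.IsClosed)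
    (hpInj : ∀ x y : ιp.domain, ιp x = ιp y → (x : Hp) = (y : Hp))
    (hmInj : ∀ x y : ιm.domain, ιm x = ιm y → (x : Hm) = (y : Hm))
    (hpRan : Dense (Set.range fun f : ιp.domain => ιp f))
    (hmRan : Dense (Set.range fun g : ιm.domain => ιm g))
    (compat : ∀ (f : ιp.domain) (g : ιm.domain),
      (⟪ιp f, ιm g⟫_ℂ) = ⟪(f : Hp), Ψ (g : Hm)⟫_ℂ)
    :
    ∃ ιmHat : Hm →ₗ.[ℂ] H0,
      Dense (ιmHat.domain : Set Hm) ∧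
      ιmHat.IsClosed ∧
      (∀ x y : ιmHat.domain, ιmHat x = ιmHat y → (x : Hm) = (y : Hm)) ∧
      Dense (Set.range fun g : ιmHat.domain => ιmHat g) ∧
      ιm ≤ ιmHat ∧
      (∀ (f : ιp.domain) (g : ιmHat.domain),
        (⟪ιp f, ιmHat g⟫_ℂ) = ⟪(f : Hp), Ψ (g : Hm)⟫_ℂ) ∧
      (Set.range fun g : ιmHat.domain => ιmHat g) = ((ιp†).domain : Set H0) := by
  obtain ⟨ιmHat, hgraph⟩ : ∃ S : Hm →ₗ.[ℂ] H0, S.graph = ιp.dualGraph Ψ :=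
    ⟨_, Submodule.toLinearPMap_graph_eq _ fun _ hp h =>
      LinearPMap.snd_eq_zero_of_mem_dualGraph hpRan hp h⟩
  have hmem (g : ιmHat.domain) : ((g : Hm), ιmHat g) ∈ ιp.dualGraph Ψ :=
    hgraph ▸ ιmHat.mem_graph g
  have hle : ιm ≤ ιmHat := LinearPMap.le_of_le_graph fun p hp => by
    obtain ⟨g, hg, hg'⟩ := (LinearPMap.mem_graph_iff ιm).1 hp
    rw [hgraph, LinearPMap.mem_dualGraph_iff, ← hg, ← hg']
    exact fun f => compat f g
  refine ⟨ιmHat, hmDense.mono hle.1, ?_, fun x y hxy => ?_, hmRan.mono ?_, hle,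
    fun f g => hmem g f, ?_⟩
  · rw [LinearPMap.IsClosed, hgraph]
    exact LinearPMap.isClosed_dualGraph
  · exact sub_eq_zero.1 <| LinearPMap.fst_eq_zero_of_mem_dualGraph hpDense
      (sub_mem (hmem x) (hmem y)) (sub_eq_zero.2 hxy)
  · rintro _ ⟨g, rfl⟩
    exact ⟨⟨g, hle.1 g.2⟩, (hle.2 rfl).symm⟩
  · ext h
    rw [SetLike.mem_coe, LinearPMap.mem_adjoint_domain_iff_exists_mem_dualGraph (Ψ := Ψ) hpDense,
      ← hgraph]
    simp [LinearPMap.mem_graph_iff]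
end

section
/- Let H₊ and H₀ be complex Hilbert spaces and ι₊ : dom ι₊ ⊆ H₊ → H₀ a densely defined, closed, injective linear operator with dense range. Then there exist a complex Hilbert space H₋, a unitary map Ψ : H₋ → H₊, and a densely defined, closed, injective linear operator ι₋ : dom ι₋ ⊆ H₋ → H₀ with dense range such that ⟨ι₋ g, ι₊ f⟩_{H₀} = ⟨Ψ g, f⟩_{H₊} for all f ∈ dom ι₊ and g ∈ dom ι₋, and ran ι₋ = dom ι₊ᴴ; i.e., (H₊, H₀, H₋) is a quasi Gelfand triple. -/
open scoped InnerProductSpace LinearPMap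

namespace LinearPMap

variable {𝕜 E F : Type*} [RCLike 𝕜]
  [NormedAddCommGroup E] [InnerProductSpace 𝕜 E] [CompleteSpace E]
  [NormedAddCommGroup F] [InnerProductSpace 𝕜 F]
  {T : E →ₗ.[𝕜] F}

/-- A closed densely defined operator contains its double adjoint. -/
theorem IsClosed.mem_graph_of_inner_adjoint_s7 [CompleteSpace F] (hT : Dense (T.domain : Set E))
    (hc : T.IsClosed) {x : E} {z : F}
    (h : ∀ y : T†.domain, ⟪x, T† y⟫_𝕜 = ⟪z, (y : F)⟫_𝕜) : (x, z) ∈ T.graph := by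
  let G : Submodule 𝕜 (WithLp 2 (E × F)) :=
    T.graph.comap (WithLp.linearEquiv 2 𝕜 (E × F)).toLinearMap
  have hG : _root_.IsClosed (G : Set (WithLp 2 (E × F))) :=
    _root_.IsClosed.preimage (WithLp.prod_continuous_ofLp 2 E F) hc
  suffices WithLp.toLp 2 (x, z) ∈ G from this
  rw [← hG.submodule_topologicalClosure_eq, ← Submodule.orthogonal_orthogonal_eq_closure,
    Submodule.mem_orthogonal']
  intro w hw
  have key : ∀ f : T.domain, ⟪-w.fst, (f : E)⟫_𝕜 = ⟪w.snd, T f⟫_𝕜 := fun f => by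
    have h0 : ⟪w, WithLp.toLp 2 ((f : E), T f)⟫_𝕜 = 0 :=
      (Submodule.mem_orthogonal' _ _).1 hw _ (T.mem_graph f)
    rw [WithLp.prod_inner_apply] at h0
    rw [inner_neg_left]
    exact neg_eq_of_add_eq_zero_right h0
  have hmem : w.snd ∈ T†.domain := mem_adjoint_domain_of_exists _ ⟨_, key⟩
  have hy := h ⟨w.snd, hmem⟩
  rw [adjoint_apply_eq hT ⟨w.snd, hmem⟩ key, inner_neg_right] at hy
  rw [WithLp.prod_inner_apply]
  change ⟪x, w.fst⟫_𝕜 + ⟪z, w.snd⟫_𝕜 = 0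
  rw [← hy, add_neg_cancel]

theorem IsClosed.dense_adjoint_domain [CompleteSpace F] (hT : Dense (T.domain : Set E))
    (hc : T.IsClosed) : Dense (T†.domain : Set F) := by
  rw [Submodule.dense_iff_topologicalClosure_eq_top, Submodule.topologicalClosure_eq_top_iff,
    Submodule.eq_bot_iff]
  intro z hz
  refine T.graph_fst_eq_zero_snd (hc.mem_graph_of_inner_adjoint_s7 hT (x := 0) fun y => ?_) rfl
  rw [inner_zero_left, (Submodule.mem_orthogonal' _ _).1 hz _ y.2]

theorem IsClosed.dense_adjoint_range [CompleteSpace F] (hT : Dense (T.domain : Set E))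
    (hc : T.IsClosed) (hker : T.toFun.ker = ⊥) : Dense (T†.toFun.range : Set E) := by
  rw [Submodule.dense_iff_topologicalClosure_eq_top, Submodule.topologicalClosure_eq_top_iff,
    Submodule.eq_bot_iff]
  intro x hx
  have hg : (x, (0 : F)) ∈ T.graph := hc.mem_graph_of_inner_adjoint_s7 hT fun y => by
    rw [inner_zero_left]
    exact (Submodule.mem_orthogonal' _ _).1 hx _ ⟨y, rfl⟩
  obtain ⟨f, rfl, hf⟩ := T.mem_graph_iff.1 hg
  exact congrArg Subtype.val (LinearMap.ker_eq_bot'.1 hker f hf)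

theorem adjoint_ker_eq_bot (hT : Dense (T.domain : Set E))
    (hran : Dense (Set.range T)) : T†.toFun.ker = ⊥ := by
  refine LinearMap.ker_eq_bot'.2 fun y hy => Subtype.ext ?_
  refine hran.eq_zero_of_inner_left 𝕜 ?_
  rintro _ ⟨f, rfl⟩
  rw [← adjoint_isFormalAdjoint hT y f]
  exact (congrArg (⟪·, (f : E)⟫_𝕜) hy).trans (inner_zero_left _)

end LinearPMap

/-- Given complex Hilbert spaces `H₊`, `H₀` and a densely defined, closed,
injective linear operator `ι₊ : dom ι₊ ⊆ H₊ → H₀` with dense range, there exist a complex Hilbert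
space `H₋`, a unitary `Ψ : H₋ → H₊` and a densely defined, closed, injective linear operator
`ι₋ : dom ι₋ ⊆ H₋ → H₀` with dense range such that
`⟨ι₋ g, ι₊ f⟩_{H₀} = ⟨Ψ g, f⟩_{H₊}` for all `f ∈ dom ι₊`, `g ∈ dom ι₋` and
`ran ι₋ = dom ι₊ᴴ`; i.e. `(H₊, H₀, H₋)` is a quasi Gelfand triple. -/
theorem stmt7 {Hp : Type u} {H0 : Type v}
    [NormedAddCommGroup Hp] [InnerProductSpace ℂ Hp] [CompleteSpace Hp]
    [NormedAddCommGroup H0] [InnerProductSpace ℂ H0] [CompleteSpace H0]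
    (ιp : Hp →ₗ.[ℂ] H0)
    (hpDense : Dense (ιp.domain : Set Hp))
    (hpClosed : ιp.IsClosed)
    (hpInj : ∀ x y : ιp.domain, ιp x = ιp y → (x : Hp) = (y : Hp))
    (hpRan : Dense (Set.range fun f : ιp.domain => ιp f)) :
    ∃ (Hm : Type u) (_ : NormedAddCommGroup Hm) (_ : InnerProductSpace ℂ Hm)
      (_ : CompleteSpace Hm) (Ψ : Hm ≃ₗᵢ[ℂ] Hp) (ιm : Hm →ₗ.[ℂ] H0),
      Dense (ιm.domain : Set Hm) ∧
      ιm.IsClosed ∧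
      (∀ x y : ιm.domain, ιm x = ιm y → (x : Hm) = (y : Hm)) ∧
      Dense (Set.range fun g : ιm.domain => ιm g) ∧
      (∀ (f : ιp.domain) (g : ιm.domain),
        (⟪ιp f, ιm g⟫_ℂ) = ⟪(f : Hp), Ψ (g : Hm)⟫_ℂ) ∧
      (Set.range fun g : ιm.domain => ιm g) = ((ιp†).domain : Set H0) := by
  have hker : ιp.toFun.ker = ⊥ :=
    LinearMap.ker_eq_bot.2 fun x y h => Subtype.ext (hpInj x y h)
  have hker' : ιp†.toFun.ker = ⊥ := LinearPMap.adjoint_ker_eq_bot hpDense hpRan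
  have hrange : (Set.range fun g : (ιp†).inverse.domain => (ιp†).inverse g)
      = ((ιp†).domain : Set H0) :=
    congrArg (SetLike.coe) (LinearPMap.inverse_range hker')
  refine ⟨Hp, inferInstance, inferInstance, inferInstance, .refl ℂ Hp, (ιp†).inverse,
    ?_, ?_, ?_, ?_, ?_, hrange⟩
  · rw [LinearPMap.inverse_domain]
    exact hpClosed.dense_adjoint_range hpDense hker
  · exact (LinearPMap.inverse_closed_iff hker').2 (LinearPMap.adjoint_isClosed hpDense)
  · have apply_inverse (x : (ιp†).inverse.domain) :
        ∃ y : (ιp†).domain, ιp† y = x ∧ (ιp†).inverse x = y := by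
      obtain ⟨y, hy⟩ := LinearPMap.inverse_domain.le x.2
      exact ⟨y, hy, LinearPMap.inverse_apply_eq hker' hy⟩
    intro x x' h
    obtain ⟨y, hy, hxy⟩ := apply_inverse x
    obtain ⟨y', hy', hxy'⟩ := apply_inverse x'
    rw [← hy, ← hy', Subtype.ext (hxy.symm.trans (h.trans hxy'))]
  · rw [hrange]
    exact hpClosed.dense_adjoint_domain hpDense
  · intro f g
    obtain ⟨y, hy⟩ := LinearPMap.inverse_domain.le g.2
    have hy : ιp† y = g := hy
    rw [LinearPMap.inverse_apply_eq hker' hy, LinearIsometryEquiv.coe_refl, id, ← hy]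
    exact (LinearPMap.adjoint_isFormalAdjoint hpDense).symm f y
end

section
/- Let (H₊, H₀, H₋) be a pre-quasi Gelfand triple of Hilbert spaces with embeddings ι₊, ι₋. Then for every h ∈ ran ι₊ ∩ ran ι₋ one has ‖h‖_{H₀} ≤ √(‖ι₊⁻¹ h‖_{H₊}² + ‖ι₋⁻¹ h‖_{H₋}²), and the set ran ι₊ ∩ ran ι₋ is complete with respect to the norm h ↦ √(‖ι₊⁻¹ h‖_{H₊}² + ‖ι₋⁻¹ h‖_{H₋}²). -/
open scoped InnerProductSpace LinearPMap

theorem norm_le_sqrt_of_eq_of_inner_eq {Hp H0 Hm : Type*}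
    [NormedAddCommGroup Hp] [InnerProductSpace ℂ Hp]
    [NormedAddCommGroup H0] [InnerProductSpace ℂ H0]
    [NormedAddCommGroup Hm] [InnerProductSpace ℂ Hm]
    (Ψ : Hm ≃ₗᵢ[ℂ] Hp) {f : Hp} {g : Hm} {a b : H0} (hab : a = b)
    (h : ⟪a, b⟫_ℂ = ⟪f, Ψ g⟫_ℂ) :
    ‖a‖ ≤ Real.sqrt (‖f‖ ^ 2 + ‖g‖ ^ 2) := by
  subst hab
  apply Real.le_sqrt_of_sq_le
  have hle : ‖⟪a, a⟫_ℂ‖ ≤ ‖f‖ * ‖g‖ := by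
    rw [h, ← Ψ.norm_map g]
    exact norm_inner_le_norm f (Ψ g)
  have hsq : ‖⟪a, a⟫_ℂ‖ = ‖a‖ ^ 2 := by
    simp [inner_self_eq_norm_sq_to_K]
  nlinarith [sq_nonneg (‖f‖ - ‖g‖), sq_nonneg ‖f‖, sq_nonneg ‖g‖]

theorem LinearPMap.IsClosed.exists_eq_of_tendsto {E F : Type*}
    [NormedAddCommGroup E] [NormedSpace ℂ E] [NormedAddCommGroup F] [NormedSpace ℂ F]
    {T : E →ₗ.[ℂ] F} (hT : T.IsClosed) {u : ℕ → T.domain} {x : E} {y : F}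
    (hx : Filter.Tendsto (fun n => (u n : E)) Filter.atTop (nhds x))
    (hy : Filter.Tendsto (fun n => T (u n)) Filter.atTop (nhds y)) :
    ∃ z : T.domain, (z : E) = x ∧ T z = y := by
  have hmem : (x, y) ∈ (T.graph : Set (E × F)) :=
    IsClosed.mem_of_tendsto hT (hx.prodMk_nhds hy)
      (Filter.Eventually.of_forall fun n => T.mem_graph (u n))
  exact T.mem_graph_iff.mp hmem

/-- In a pre-quasi Gelfand triple `(H₊, H₀, H₋)` with embeddings `ι₊`, `ι₋`, every
`h ∈ ran ι₊ ∩ ran ι₋` (written `h = ι₊ f = ι₋ g`, the preimages `f = ι₊⁻¹ h`, `g = ι₋⁻¹ h` being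
unique by injectivity) satisfies `‖h‖_{H₀} ≤ √(‖f‖_{H₊}² + ‖g‖_{H₋}²)`, and `ran ι₊ ∩ ran ι₋` is
complete with respect to the norm `h ↦ √(‖ι₊⁻¹ h‖_{H₊}² + ‖ι₋⁻¹ h‖_{H₋}²)` (stated via Cauchy
sequences of preimage pairs). -/
theorem stmt8 {Hp H0 Hm : Type*}
    [NormedAddCommGroup Hp] [InnerProductSpace ℂ Hp] [CompleteSpace Hp]
    [NormedAddCommGroup H0] [InnerProductSpace ℂ H0] [CompleteSpace H0]
    [NormedAddCommGroup Hm] [InnerProductSpace ℂ Hm] [CompleteSpace Hm]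
    (Ψ : Hm ≃ₗᵢ[ℂ] Hp)
    (ιp : Hp →ₗ.[ℂ] H0) (ιm : Hm →ₗ.[ℂ] H0)
    (hpDense : Dense (ιp.domain : Set Hp))
    (hmDense : Dense (ιm.domain : Set Hm))
    (hpClosed : ιp.IsClosed) (hmClosed : ιm.IsClosed)
    (hpInj : ∀ x y : ιp.domain, ιp x = ιp y → (x : Hp) = (y : Hp))
    (hmInj : ∀ x y : ιm.domain, ιm x = ιm y → (x : Hm) = (y : Hm))
    (hpRan : Dense (Set.range fun f : ιp.domain => ιp f))
    (hmRan : Dense (Set.range fun g : ιm.domain => ιm g))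
    (compat : ∀ (f : ιp.domain) (g : ιm.domain),
      (⟪ιp f, ιm g⟫_ℂ) = ⟪(f : Hp), Ψ (g : Hm)⟫_ℂ)
    :
    (∀ (f : ιp.domain) (g : ιm.domain), ιp f = ιm g →
      ‖ιp f‖ ≤ Real.sqrt (‖(f : Hp)‖ ^ 2 + ‖(g : Hm)‖ ^ 2)) ∧
    ∀ (F : ℕ → ιp.domain) (G : ℕ → ιm.domain),
      (∀ n, ιp (F n) = ιm (G n)) →
      (∀ ε > (0 : ℝ), ∃ n₀ : ℕ, ∀ n ≥ n₀, ∀ m ≥ n₀,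
        Real.sqrt (‖(F n : Hp) - (F m : Hp)‖ ^ 2 + ‖(G n : Hm) - (G m : Hm)‖ ^ 2) < ε) →
      ∃ (Finf : ιp.domain) (Ginf : ιm.domain), ιp Finf = ιm Ginf ∧
        ∀ ε > (0 : ℝ), ∃ n₀ : ℕ, ∀ n ≥ n₀,
          Real.sqrt (‖(F n : Hp) - (Finf : Hp)‖ ^ 2 + ‖(G n : Hm) - (Ginf : Hm)‖ ^ 2) < ε := by
  have bound : ∀ (f : ιp.domain) (g : ιm.domain), ιp f = ιm g →
      ‖ιp f‖ ≤ Real.sqrt (‖(f : Hp)‖ ^ 2 + ‖(g : Hm)‖ ^ 2) := fun f g h =>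
    norm_le_sqrt_of_eq_of_inner_eq Ψ h (compat f g)
  refine ⟨bound, fun F G hFG hC => ?_⟩
  have cauchyF : CauchySeq fun n => (F n : Hp) := by
    refine Metric.cauchySeq_iff.mpr fun ε hε => (hC ε hε).imp fun N hN m hm n hn => ?_
    rw [dist_eq_norm]
    exact (Real.le_sqrt_of_sq_le (le_add_of_nonneg_right (sq_nonneg _))).trans_lt (hN m hm n hn)
  have cauchyG : CauchySeq fun n => (G n : Hm) := by
    refine Metric.cauchySeq_iff.mpr fun ε hε => (hC ε hε).imp fun N hN m hm n hn => ?_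
    rw [dist_eq_norm]
    exact (Real.le_sqrt_of_sq_le (le_add_of_nonneg_left (sq_nonneg _))).trans_lt (hN m hm n hn)
  have cauchyH : CauchySeq fun n => ιp (F n) := by
    refine Metric.cauchySeq_iff.mpr fun ε hε => (hC ε hε).imp fun N hN m hm n hn => ?_
    rw [dist_eq_norm, ← ιp.map_sub]
    refine (bound (F m - F n) (G m - G n) ?_).trans_lt (hN m hm n hn)
    rw [ιp.map_sub, ιm.map_sub, hFG, hFG]
  obtain ⟨f, hf⟩ := cauchySeq_tendsto_of_complete cauchyF
  obtain ⟨g, hg⟩ := cauchySeq_tendsto_of_complete cauchyG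
  obtain ⟨h, hh⟩ := cauchySeq_tendsto_of_complete cauchyH
  obtain ⟨f', rfl, hf'⟩ := hpClosed.exists_eq_of_tendsto hf hh
  obtain ⟨g', rfl, hg'⟩ := hmClosed.exists_eq_of_tendsto hg (by simpa only [hFG] using hh)
  refine ⟨f', g', hf'.trans hg'.symm, fun ε hε => ?_⟩
  have hlim : Filter.Tendsto
      (fun n => Real.sqrt (‖(F n : Hp) - (f' : Hp)‖ ^ 2 + ‖(G n : Hm) - (g' : Hm)‖ ^ 2))
      Filter.atTop (nhds 0) := by
    simpa using ((((hf.sub_const (f' : Hp)).norm.pow 2).add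
      ((hg.sub_const (g' : Hm)).norm.pow 2)).sqrt)
  exact Filter.eventually_atTop.mp (hlim.eventually_lt_const hε)
end

section
/- Let (H₊, H₀, H₋) be a pre-quasi Gelfand triple of Hilbert spaces with embeddings ι₊, ι₋. Then the linear operator [ι₊ ι₋] : dom ι₊ × dom ι₋ ⊆ H₊ × H₋ → H₀ defined by (f, g) ↦ ι₊ f + ι₋ g is closed: whenever fₙ ∈ dom ι₊ converges to f in H₊, gₙ ∈ dom ι₋ converges to g in H₋, and ι₊ fₙ + ι₋ gₙ converges to z in H₀, it follows that f ∈ dom ι₊, g ∈ dom ι₋ and ι₊ f + ι₋ g = z. -/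
open Filter Topology
open scoped InnerProductSpace LinearPMap

/-- If `‖u - u'‖ ^ 2` is controlled by the increments of three Cauchy sequences, then so is
the sequence `u`. -/
theorem cauchySeq_of_norm_sub_sq_le {A B C D : Type*}
    [SeminormedAddCommGroup A] [SeminormedAddCommGroup B] [SeminormedAddCommGroup C]
    [SeminormedAddCommGroup D] {u : ℕ → A} {s : ℕ → B} {x : ℕ → C} {y : ℕ → D}
    (hs : CauchySeq s) (hx : CauchySeq x) (hy : CauchySeq y)
    (h : ∀ m n, ‖u m - u n‖ ^ 2 ≤ ‖s m - s n‖ ^ 2 + 2 * (‖x m - x n‖ * ‖y m - y n‖)) :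
    CauchySeq u := by
  rw [Metric.cauchySeq_iff] at *
  intro ε hε
  obtain ⟨N₁, h₁⟩ := hs (ε / 2) (half_pos hε)
  obtain ⟨N₂, h₂⟩ := hx (ε / 2) (half_pos hε)
  obtain ⟨N₃, h₃⟩ := hy (ε / 2) (half_pos hε)
  refine ⟨max N₁ (max N₂ N₃), fun m hm n hn => ?_⟩
  simp only [ge_iff_le, max_le_iff] at hm hn
  have k₁ := h₁ m hm.1 n hn.1
  have k₂ := h₂ m hm.2.1 n hn.2.1
  have k₃ := h₃ m hm.2.2 n hn.2.2
  rw [dist_eq_norm] at *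
  have hsq : ‖s m - s n‖ ^ 2 ≤ (ε / 2) ^ 2 := by gcongr
  have hmul : ‖x m - x n‖ * ‖y m - y n‖ ≤ ε / 2 * (ε / 2) := by gcongr
  refine lt_of_pow_lt_pow_left₀ 2 hε.le ?_
  nlinarith [h m n]

theorem LinearPMap.IsClosed.exists_apply_eq_of_tendsto {E F : Type*}
    [NormedAddCommGroup E] [NormedSpace ℂ E] [NormedAddCommGroup F] [NormedSpace ℂ F]
    {T : E →ₗ.[ℂ] F} (hT : T.IsClosed) {u : ℕ → T.domain} {x : E} {y : F}
    (hx : Tendsto (fun n => (u n : E)) atTop (𝓝 x))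
    (hy : Tendsto (fun n => T (u n)) atTop (𝓝 y)) :
    ∃ h : x ∈ T.domain, T ⟨x, h⟩ = y := by
  have hmem : (x, y) ∈ T.graph :=
    IsClosed.mem_of_tendsto hT (hx.prodMk_nhds hy) (Eventually.of_forall fun n => T.mem_graph (u n))
  obtain ⟨v, rfl, rfl⟩ := T.mem_graph_iff.mp hmem
  exact ⟨v.2, rfl⟩

/-- If `⟪a, b⟫ = ⟪x, y⟫`, then the squares of `a` and `b` are controlled by `a + b`, `x`, `y`. -/
theorem norm_sq_add_norm_sq_le_of_inner_eq {E F : Type*}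
    [NormedAddCommGroup E] [InnerProductSpace ℂ E]
    [NormedAddCommGroup F] [InnerProductSpace ℂ F] {a b : F} {x y : E}
    (h : ⟪a, b⟫_ℂ = ⟪x, y⟫_ℂ) :
    ‖a‖ ^ 2 + ‖b‖ ^ 2 ≤ ‖a + b‖ ^ 2 + 2 * (‖x‖ * ‖y‖) := by
  have h₁ := norm_add_sq (𝕜 := ℂ) a b
  have h₂ := (abs_le.mp ((RCLike.abs_re_le_norm ⟪x, y⟫_ℂ).trans (norm_inner_le_norm x y))).1
  rw [h] at h₁
  linarith

/-- In a pre-quasi Gelfand triple `(H₊, H₀, H₋)` with embeddings `ι₊`, `ι₋`, the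
operator `[ι₊ ι₋] : dom ι₊ × dom ι₋ ⊆ H₊ × H₋ → H₀`, `(f,g) ↦ ι₊ f + ι₋ g` is closed: if
`fₙ → f` in `H₊`, `gₙ → g` in `H₋` and `ι₊ fₙ + ι₋ gₙ → z` in `H₀`, then `f ∈ dom ι₊`,
`g ∈ dom ι₋` and `ι₊ f + ι₋ g = z`. -/
theorem stmt9 {Hp H0 Hm : Type*}
    [NormedAddCommGroup Hp] [InnerProductSpace ℂ Hp] [CompleteSpace Hp]
    [NormedAddCommGroup H0] [InnerProductSpace ℂ H0] [CompleteSpace H0]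
    [NormedAddCommGroup Hm] [InnerProductSpace ℂ Hm] [CompleteSpace Hm]
    (Ψ : Hm ≃ₗᵢ[ℂ] Hp)
    (ιp : Hp →ₗ.[ℂ] H0) (ιm : Hm →ₗ.[ℂ] H0)
    (hpDense : Dense (ιp.domain : Set Hp))
    (hmDense : Dense (ιm.domain : Set Hm))
    (hpClosed : ιp.IsClosed) (hmClosed : ιm.IsClosed)
    (hpInj : ∀ x y : ιp.domain, ιp x = ιp y → (x : Hp) = (y : Hp))
    (hmInj : ∀ x y : ιm.domain, ιm x = ιm y → (x : Hm) = (y : Hm))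
    (hpRan : Dense (Set.range fun f : ιp.domain => ιp f))
    (hmRan : Dense (Set.range fun g : ιm.domain => ιm g))
    (compat : ∀ (f : ιp.domain) (g : ιm.domain),
      (⟪ιp f, ιm g⟫_ℂ) = ⟪(f : Hp), Ψ (g : Hm)⟫_ℂ)
    (F : ℕ → ιp.domain) (G : ℕ → ιm.domain) (f : Hp) (g : Hm) (z : H0)
    (hF : Tendsto (fun n => (F n : Hp)) atTop (𝓝 f))
    (hG : Tendsto (fun n => (G n : Hm)) atTop (𝓝 g))
    (hsum : Tendsto (fun n => ιp (F n) + ιm (G n)) atTop (𝓝 z)) :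
    ∃ (hf : f ∈ ιp.domain) (hg : g ∈ ιm.domain), ιp ⟨f, hf⟩ + ιm ⟨g, hg⟩ = z := by
  have key : ∀ m n, ‖ιp (F m) - ιp (F n)‖ ^ 2 + ‖ιm (G m) - ιm (G n)‖ ^ 2 ≤
      ‖(ιp (F m) + ιm (G m)) - (ιp (F n) + ιm (G n))‖ ^ 2 +
        2 * (‖(F m : Hp) - F n‖ * ‖(G m : Hm) - G n‖) := by
    intro m n
    have h := norm_sq_add_norm_sq_le_of_inner_eq (compat (F m - F n) (G m - G n))
    rw [Ψ.norm_map, LinearPMap.map_sub, LinearPMap.map_sub] at h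
    rw [add_sub_add_comm]
    exact h
  obtain ⟨a, ha⟩ := cauchySeq_tendsto_of_complete <|
    cauchySeq_of_norm_sub_sq_le (u := fun n => ιp (F n)) hsum.cauchySeq hF.cauchySeq hG.cauchySeq
      fun m n => (le_add_of_nonneg_right (sq_nonneg _)).trans (key m n)
  obtain ⟨b, hb⟩ := cauchySeq_tendsto_of_complete <|
    cauchySeq_of_norm_sub_sq_le (u := fun n => ιm (G n)) hsum.cauchySeq hF.cauchySeq hG.cauchySeq
      fun m n => (le_add_of_nonneg_left (sq_nonneg _)).trans (key m n)
  obtain ⟨hf, rfl⟩ := hpClosed.exists_apply_eq_of_tendsto hF ha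
  obtain ⟨hg, rfl⟩ := hmClosed.exists_apply_eq_of_tendsto hG hb
  exact ⟨hf, hg, tendsto_nhds_unique (ha.add hb) hsum⟩
end

section
/- Let (H₊, H₀, H₋) be a quasi Gelfand triple of Hilbert spaces with embeddings ι₊, ι₋. Then the set ran ι₊ ∩ ran ι₋ is dense in H₀ with respect to ‖·‖_{H₀}. -/
open scoped InnerProductSpace LinearPMap

namespace LinearPMap

variable {𝕜 E F : Type*} [RCLike 𝕜]
  [NormedAddCommGroup E] [InnerProductSpace 𝕜 E] [CompleteSpace E]
  [NormedAddCommGroup F] [InnerProductSpace 𝕜 F] [CompleteSpace F]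

/-- The values in the adjoint domain of a closed operator with dense range are dense. -/
theorem IsClosed.dense_range_inter_adjoint_domain {T : E →ₗ.[𝕜] F} (hT : T.IsClosed)
    (hdense : DenseRange fun x : T.domain => T x) :
    Dense ((Set.range fun x : T.domain => T x) ∩ (T†.domain : Set F)) := by
  let G : Submodule 𝕜 (WithLp 2 (E × F)) :=
    T.graph.comap (WithLp.prodContinuousLinearEquiv 2 𝕜 E F).toLinearMap
  have hG : _root_.IsClosed (G : Set (WithLp 2 (E × F))) :=
    _root_.IsClosed.preimage (WithLp.prodContinuousLinearEquiv 2 𝕜 E F).continuous hT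
  have : CompleteSpace G := hG.completeSpace_coe
  let fstG : G →L[𝕜] E :=
    (ContinuousLinearMap.fst 𝕜 E F).comp
      ((WithLp.prodContinuousLinearEquiv 2 𝕜 E F).toContinuousLinearMap.comp G.subtypeL)
  let sndG : G →L[𝕜] F :=
    (ContinuousLinearMap.snd 𝕜 E F).comp
      ((WithLp.prodContinuousLinearEquiv 2 𝕜 E F).toContinuousLinearMap.comp G.subtypeL)
  have mem_graph (g : G) : (fstG g, sndG g) ∈ T.graph := g.2
  have hker : fstG.ker = ⊥ := by
    rw [LinearMap.ker_eq_bot']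
    intro g hg
    replace hg : fstG g = 0 := hg
    have h2 : sndG g = 0 := T.graph_fst_eq_zero_snd (mem_graph g) hg
    exact Subtype.ext (WithLp.ofLp_injective 2 (Prod.ext hg h2))
  have hadj : DenseRange fstG.adjoint := by
    have h := ContinuousLinearMap.orthogonal_range fstG.adjoint
    rw [ContinuousLinearMap.adjoint_adjoint, hker] at h
    exact Submodule.dense_iff_topologicalClosure_eq_top.2
      ((Submodule.topologicalClosure_eq_top_iff).2 h)
  have hsnd : DenseRange sndG := by
    refine Dense.mono ?_ hdense
    rintro _ ⟨x, rfl⟩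
    exact ⟨⟨WithLp.toLp 2 (x, T x), T.mem_graph x⟩, rfl⟩
  refine Dense.mono ?_ (hsnd.comp hadj sndG.continuous)
  rintro _ ⟨h, rfl⟩
  set g := fstG.adjoint h with hg
  obtain ⟨y, hy, hTy⟩ := (T.mem_graph_iff).1 (mem_graph g)
  refine ⟨⟨y, hTy⟩, T.mem_adjoint_domain_of_exists _ ⟨h - fstG g, fun x => ?_⟩⟩
  have key := ContinuousLinearMap.adjoint_inner_left fstG
    ⟨WithLp.toLp 2 (x, T x), T.mem_graph x⟩ h
  rw [← hg, Submodule.coe_inner, WithLp.prod_inner_apply] at key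
  change inner 𝕜 (fstG g) (x : E) + inner 𝕜 (sndG g) (T x) = inner 𝕜 h (x : E) at key
  rw [inner_sub_left, ← key, add_sub_cancel_left]
  rfl

end LinearPMap

/-- In a quasi Gelfand triple `(H₊, H₀, H₋)` with embeddings `ι₊`, `ι₋`, the set
`ran ι₊ ∩ ran ι₋` is dense in `H₀`. -/
theorem stmt10 {Hp H0 Hm : Type*}
    [NormedAddCommGroup Hp] [InnerProductSpace ℂ Hp] [CompleteSpace Hp]
    [NormedAddCommGroup H0] [InnerProductSpace ℂ H0] [CompleteSpace H0]
    [NormedAddCommGroup Hm] [InnerProductSpace ℂ Hm] [CompleteSpace Hm]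
    (Ψ : Hm ≃ₗᵢ[ℂ] Hp)
    (ιp : Hp →ₗ.[ℂ] H0) (ιm : Hm →ₗ.[ℂ] H0)
    (hpDense : Dense (ιp.domain : Set Hp))
    (hmDense : Dense (ιm.domain : Set Hm))
    (hpClosed : ιp.IsClosed) (hmClosed : ιm.IsClosed)
    (hpInj : ∀ x y : ιp.domain, ιp x = ιp y → (x : Hp) = (y : Hp))
    (hmInj : ∀ x y : ιm.domain, ιm x = ιm y → (x : Hm) = (y : Hm))
    (hpRan : Dense (Set.range fun f : ιp.domain => ιp f))
    (hmRan : Dense (Set.range fun g : ιm.domain => ιm g))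
    (compat : ∀ (f : ιp.domain) (g : ιm.domain),
      (⟪ιp f, ιm g⟫_ℂ) = ⟪(f : Hp), Ψ (g : Hm)⟫_ℂ)
    (hquasi : ((ιp†).domain : Set H0) = Set.range fun g : ιm.domain => ιm g) :
    Dense ((Set.range fun f : ιp.domain => ιp f) ∩
      (Set.range fun g : ιm.domain => ιm g)) := by
  rw [← hquasi]
  exact hpClosed.dense_range_inter_adjoint_domain hpRan
end

section
/- Let (H₊, H₀, H₋) be a quasi Gelfand triple of Hilbert spaces with embeddings ι₊, ι₋. Then ι₊⁻¹(ran ι₊ ∩ ran ι₋) is dense in H₊ and ι₋⁻¹(ran ι₊ ∩ ran ι₋) is dense in H₋; moreover ι₊⁻¹(ran ι₊ ∩ ran ι₋) is a core of ι₊ (the closure of the restriction of ι₊ to this set equals ι₊) and ι₋⁻¹(ran ι₊ ∩ ran ι₋) is a core of ι₋. -/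
open scoped InnerProductSpace LinearPMap

namespace LinearPMap

section Core

variable {𝕜 E F : Type*} [NormedField 𝕜]
  [NormedAddCommGroup E] [NormedSpace 𝕜 E] [NormedAddCommGroup F] [NormedSpace 𝕜 F]

/-- A core of a closed, densely defined operator is dense. -/
theorem HasCore.dense {T : E →ₗ.[𝕜] F} {S : Submodule 𝕜 E} (hS : T.HasCore S)
    (hT : T.IsClosed) (hdense : Dense (T.domain : Set E)) : Dense (S : Set E) := by
  have hgraph : (T.domRestrict S).graph.topologicalClosure = T.graph := by
    rw [(hT.isClosable.leIsClosable domRestrict_le).graph_closure_eq_closure_graph, hasCore_def hS]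
  refine dense_closure.mp (hdense.mono fun x hx => ?_)
  have hmem : (x, T ⟨x, hx⟩) ∈ _root_.closure ((T.domRestrict S).graph : Set (E × F)) := by
    rw [← Submodule.topologicalClosure_coe, hgraph]
    exact T.mem_graph ⟨x, hx⟩
  refine map_mem_closure continuous_fst hmem fun p hp => ?_
  obtain ⟨y, hy, -⟩ := (mem_graph_iff _).mp hp
  exact hy ▸ y.2.1

end Core

variable {𝕜 E F : Type*} [RCLike 𝕜]
  [NormedAddCommGroup E] [InnerProductSpace 𝕜 E] [NormedAddCommGroup F] [InnerProductSpace 𝕜 F]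

/-- The graph of `T`, as a submodule of the Hilbert sum `WithLp 2 (E × F)`. -/
def graphL2 (T : E →ₗ.[𝕜] F) : Submodule 𝕜 (WithLp 2 (E × F)) :=
  T.graph.comap (WithLp.linearEquiv 2 𝕜 (E × F)).toLinearMap

theorem mem_graphL2_iff {T : E →ₗ.[𝕜] F} {v : WithLp 2 (E × F)} :
    v ∈ T.graphL2 ↔ ∃ x : T.domain, (x : E) = v.fst ∧ T x = v.snd :=
  T.mem_graph_iff

theorem toLp_mem_graphL2 {T : E →ₗ.[𝕜] F} (x : T.domain) :
    WithLp.toLp 2 ((x : E), T x) ∈ T.graphL2 :=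
  T.mem_graph x

theorem IsClosed.isClosed_graphL2 {T : E →ₗ.[𝕜] F} (hT : T.IsClosed) :
    _root_.IsClosed (T.graphL2 : Set (WithLp 2 (E × F))) :=
  _root_.IsClosed.preimage (WithLp.prod_continuous_ofLp 2 E F) hT

theorem mem_orthogonal_graphL2_iff {T : E →ₗ.[𝕜] F} {v : WithLp 2 (E × F)} :
    v ∈ T.graphL2ᗮ ↔ ∀ x : T.domain, inner 𝕜 (x : E) v.fst + inner 𝕜 (T x) v.snd = 0 := by
  rw [Submodule.mem_orthogonal]
  constructor
  · intro h x
    simpa [WithLp.prod_inner_apply] using h _ (toLp_mem_graphL2 x)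
  · intro h u hu
    obtain ⟨x, hx, hTx⟩ := mem_graphL2_iff.mp hu
    have := h x
    rw [hx, hTx] at this
    simpa [WithLp.prod_inner_apply] using this

variable [CompleteSpace E] [CompleteSpace F]

/-- The range of `1 + T†T` is the whole space when `T` is closed. -/
theorem IsClosed.exists_add_eq {T : E →ₗ.[𝕜] F} (hT : T.IsClosed) (u : E) :
    ∃ (h : T.domain) (w : E), (h : E) + w = u ∧
      ∀ x : T.domain, inner 𝕜 w (x : E) = inner 𝕜 (T h) (T x) := by
  have : CompleteSpace T.graphL2 := hT.isClosed_graphL2.completeSpace_coe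
  obtain ⟨a, ha, b, hb, hab⟩ :=
    T.graphL2.exists_add_mem_mem_orthogonal (WithLp.toLp 2 (u, (0 : F)))
  obtain ⟨h, hh, hTh⟩ := mem_graphL2_iff.mp ha
  have h1 : u = a.fst + b.fst := congrArg WithLp.fst hab
  have h2 : 0 = a.snd + b.snd := congrArg WithLp.snd hab
  refine ⟨h, b.fst, by rw [hh, h1], fun x => ?_⟩
  have hx := mem_orthogonal_graphL2_iff.mp hb x
  rw [eq_neg_of_add_eq_zero_right h2.symm, inner_neg_right, ← sub_eq_add_neg, sub_eq_zero] at hx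
  rw [← inner_conj_symm, hx, inner_conj_symm, hTh]

/-- A closed restriction `B` of `A` equals `A` if its graph has trivial orthogonal complement
in the graph of `A`. -/
theorem IsClosed.eq_of_le {A B : E →ₗ.[𝕜] F} (hB : B.IsClosed) (hBA : B ≤ A)
    (horth : ∀ x : A.domain,
      (∀ h : B.domain, inner 𝕜 (h : E) (x : E) + inner 𝕜 (B h) (A x) = 0) → (x : E) = 0) :
    B = A := by
  refine le_antisymm hBA (le_of_le_graph ?_)
  have : CompleteSpace B.graphL2 := hB.isClosed_graphL2.completeSpace_coe
  have hle : B.graphL2 ≤ A.graphL2 := Submodule.comap_mono (le_graph_of_le hBA)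
  have hbot : B.graphL2ᗮ ⊓ A.graphL2 = ⊥ := by
    rw [eq_bot_iff]
    rintro v ⟨hv, hvA⟩
    obtain ⟨x, hx, hAx⟩ := mem_graphL2_iff.mp hvA
    have hx0 : (x : E) = 0 := horth x (by
      rw [hx, hAx]
      exact mem_orthogonal_graphL2_iff.mp hv)
    obtain rfl : x = 0 := Subtype.ext hx0
    rw [Submodule.mem_bot]
    refine (WithLp.ofLp_injective 2) (Prod.ext hx.symm ?_)
    exact hAx.symm.trans A.map_zero
  have hsup := Submodule.sup_orthogonal_inf_of_hasOrthogonalProjection hle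
  rw [hbot, sup_bot_eq] at hsup
  intro p hp
  have : WithLp.toLp 2 p ∈ B.graphL2 := hsup ▸ (show WithLp.toLp 2 p ∈ A.graphL2 from hp)
  exact this

/-- The preimage under a closed operator `T` of a submodule containing `ran T ∩ dom T†` is a core
of `T`. -/
theorem IsClosed.hasCore_comap {T : E →ₗ.[𝕜] F} (hT : T.IsClosed) (R : Submodule 𝕜 F)
    (hR : ∀ x : T.domain, T x ∈ T†.domain → T x ∈ R) :
    T.HasCore ((R.comap T.toFun).map T.domain.subtype) := by
  refine ⟨Submodule.map_subtype_le _ _, ?_⟩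
  set S := (R.comap T.toFun).map T.domain.subtype with hS
  have hclosable : (T.domRestrict S).IsClosable := hT.isClosable.leIsClosable domRestrict_le
  have hle : (T.domRestrict S).closure ≤ T := by
    refine le_of_le_graph ?_
    rw [← hclosable.graph_closure_eq_closure_graph]
    exact Submodule.topologicalClosure_minimal _ (le_graph_of_le domRestrict_le) hT
  refine hclosable.closure_isClosed.eq_of_le hle fun x hx => ?_
  obtain ⟨h, w, hw, hadj⟩ := hT.exists_add_eq (x : E)
  have hhS : (h : E) ∈ S :=
    ⟨h, hR h (mem_adjoint_domain_of_exists _ ⟨w, hadj⟩), rfl⟩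
  have hmem : (h : E) ∈ (T.domRestrict S).closure.domain :=
    (le_closure _).1 ⟨hhS, h.2⟩
  have hval : (T.domRestrict S).closure ⟨h, hmem⟩ = T h := hle.2 rfl
  have hzero := hx ⟨h, hmem⟩
  rw [hval, ← hadj x, ← inner_add_left, hw] at hzero
  exact inner_self_eq_zero.mp hzero

/-- If `S` is paired with `T` through the unitary `Ψ` and `dom T†` is contained in `ran S`, then
`dom S†` is contained in `ran T`. -/
theorem IsClosed.adjoint_domain_le_range {G : Type*} [NormedAddCommGroup G]
    [InnerProductSpace 𝕜 G] [CompleteSpace G] {T : E →ₗ.[𝕜] F} {S : G →ₗ.[𝕜] F}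
    (Ψ : G ≃ₗᵢ[𝕜] E) (hT : T.IsClosed) (hTdense : Dense (T.domain : Set E))
    (hSdense : Dense (S.domain : Set G))
    (compat : ∀ (f : T.domain) (g : S.domain),
      inner 𝕜 (T f) (S g) = inner 𝕜 (f : E) (Ψ (g : G)))
    (hTS : T†.domain ≤ LinearMap.range S.toFun) :
    S†.domain ≤ LinearMap.range T.toFun := by
  intro y hy
  set w := S† ⟨y, hy⟩ with hw
  have hadj : ∀ g : S.domain, inner 𝕜 w (g : G) = inner 𝕜 y (S g) :=
    fun g => adjoint_isFormalAdjoint hSdense ⟨y, hy⟩ g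
  have : CompleteSpace T.graphL2 := hT.isClosed_graphL2.completeSpace_coe
  suffices hmem : WithLp.toLp 2 (Ψ w, y) ∈ T.graphL2 by
    obtain ⟨x, -, hx⟩ := mem_graphL2_iff.mp hmem
    exact ⟨x, hx⟩
  rw [← T.graphL2.orthogonal_orthogonal, Submodule.mem_orthogonal]
  intro b hb
  have hb' := mem_orthogonal_graphL2_iff.mp hb
  have hbdom : b.snd ∈ T†.domain := by
    refine mem_adjoint_domain_of_exists _ ⟨-b.fst, fun x => ?_⟩
    rw [← inner_conj_symm, ← inner_conj_symm b.snd, inner_neg_right,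
      eq_neg_of_add_eq_zero_right (hb' x)]
  obtain ⟨g, hg⟩ := hTS hbdom
  replace hg : S g = b.snd := hg
  have hfst : b.fst = -Ψ (g : G) := by
    refine hTdense.eq_of_inner_right 𝕜 fun v hv => ?_
    have := hb' ⟨v, hv⟩
    rw [← hg, compat] at this
    rw [inner_neg_right]
    exact eq_neg_of_add_eq_zero_left this
  have hgw : inner 𝕜 (g : G) w = inner 𝕜 (S g) y := by
    rw [← inner_conj_symm, hadj, inner_conj_symm]
  simp [WithLp.prod_inner_apply, hfst, ← hg, hgw]

end LinearPMap

/-- In a quasi Gelfand triple `(H₊, H₀, H₋)` with embeddings `ι₊`, `ι₋`, the set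
`ι₊⁻¹(ran ι₊ ∩ ran ι₋)` is dense in `H₊` and is a core of `ι₊` (the closure of the restriction of
`ι₊` to it is `ι₊` again), and likewise `ι₋⁻¹(ran ι₊ ∩ ran ι₋)` is dense in `H₋` and is a core of
`ι₋`. -/
theorem stmt11 {Hp H0 Hm : Type*}
    [NormedAddCommGroup Hp] [InnerProductSpace ℂ Hp] [CompleteSpace Hp]
    [NormedAddCommGroup H0] [InnerProductSpace ℂ H0] [CompleteSpace H0]
    [NormedAddCommGroup Hm] [InnerProductSpace ℂ Hm] [CompleteSpace Hm]
    (Ψ : Hm ≃ₗᵢ[ℂ] Hp)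
    (ιp : Hp →ₗ.[ℂ] H0) (ιm : Hm →ₗ.[ℂ] H0)
    (hpDense : Dense (ιp.domain : Set Hp))
    (hmDense : Dense (ιm.domain : Set Hm))
    (hpClosed : ιp.IsClosed) (hmClosed : ιm.IsClosed)
    (hpInj : ∀ x y : ιp.domain, ιp x = ιp y → (x : Hp) = (y : Hp))
    (hmInj : ∀ x y : ιm.domain, ιm x = ιm y → (x : Hm) = (y : Hm))
    (hpRan : Dense (Set.range fun f : ιp.domain => ιp f))
    (hmRan : Dense (Set.range fun g : ιm.domain => ιm g))
    (compat : ∀ (f : ιp.domain) (g : ιm.domain),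
      (⟪ιp f, ιm g⟫_ℂ) = ⟪(f : Hp), Ψ (g : Hm)⟫_ℂ)
    (hquasi : ((ιp†).domain : Set H0) = Set.range fun g : ιm.domain => ιm g) :
    Dense (((Submodule.comap ιp.toFun
        (LinearMap.range ιp.toFun ⊓ LinearMap.range ιm.toFun)).map
        ιp.domain.subtype : Submodule ℂ Hp) : Set Hp) ∧
    Dense (((Submodule.comap ιm.toFun
        (LinearMap.range ιp.toFun ⊓ LinearMap.range ιm.toFun)).map
        ιm.domain.subtype : Submodule ℂ Hm) : Set Hm) ∧
    (ιp.domRestrict ((Submodule.comap ιp.toFun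
        (LinearMap.range ιp.toFun ⊓ LinearMap.range ιm.toFun)).map
        ιp.domain.subtype)).closure = ιp ∧
    (ιm.domRestrict ((Submodule.comap ιm.toFun
        (LinearMap.range ιp.toFun ⊓ LinearMap.range ιm.toFun)).map
        ιm.domain.subtype)).closure = ιm := by
  have hp : ιp†.domain ≤ LinearMap.range ιm.toFun := fun y hy => by
    have : y ∈ ((ιp†).domain : Set H0) := hy
    rw [hquasi] at this
    exact this
  have hm : ιm†.domain ≤ LinearMap.range ιp.toFun :=
    hpClosed.adjoint_domain_le_range Ψ hpDense hmDense compat hp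
  have hpCore := hpClosed.hasCore_comap (LinearMap.range ιp.toFun ⊓ LinearMap.range ιm.toFun)
    fun x hx => ⟨⟨x, rfl⟩, hp hx⟩
  have hmCore := hmClosed.hasCore_comap (LinearMap.range ιp.toFun ⊓ LinearMap.range ιm.toFun)
    fun x hx => ⟨hm hx, ⟨x, rfl⟩⟩
  exact ⟨hpCore.dense hpClosed hpDense, hmCore.dense hmClosed hmDense,
    hpCore.closure_eq, hmCore.closure_eq⟩
end

section
/- Let (H₊, H₀, H₋) be a quasi Gelfand triple of Hilbert spaces with embeddings ι₊, ι₋. Then ran ι₊ + ran ι₋ = H₀, i.e., every x ∈ H₀ can be written as x = ι₊ f + ι₋ g with f ∈ dom ι₊ and g ∈ dom ι₋. -/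
open scoped InnerProductSpace LinearPMap

/-- If `T` is closed, then every vector is the sum of an element of the range of
`T` and an element of the domain of its adjoint: project `(0, x)` orthogonally onto the graph. -/
theorem LinearPMap.IsClosed.exists_eq_add_mem_adjoint_domain {𝕜 E F : Type*} [RCLike 𝕜]
    [NormedAddCommGroup E] [InnerProductSpace 𝕜 E] [CompleteSpace E]
    [NormedAddCommGroup F] [InnerProductSpace 𝕜 F] [CompleteSpace F]
    {T : E →ₗ.[𝕜] F} (hT : T.IsClosed) (x : F) :
    ∃ f : T.domain, ∃ y ∈ T†.domain, x = T f + y := by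
  let K : Submodule 𝕜 (WithLp 2 (E × F)) :=
    T.graph.comap (WithLp.linearEquiv 2 𝕜 (E × F)).toLinearMap
  have hK : _root_.IsClosed (K : Set (WithLp 2 (E × F))) :=
    _root_.IsClosed.preimage (WithLp.prod_continuous_ofLp 2 E F) hT
  have : CompleteSpace K := hK.completeSpace_coe
  obtain ⟨u, hu, v, hv, huv⟩ := K.exists_add_mem_mem_orthogonal (WithLp.toLp 2 ((0 : E), x))
  obtain ⟨f, hf, hTf⟩ := T.mem_graph_iff.1 hu
  refine ⟨f, v.snd, mem_adjoint_domain_of_exists v.snd ⟨-v.fst, fun z => ?_⟩, ?_⟩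
  · have hz : WithLp.toLp 2 ((z : E), T z) ∈ K := T.mem_graph z
    have h := Submodule.inner_left_of_mem_orthogonal hz hv
    rw [WithLp.prod_inner_apply] at h
    rw [inner_neg_left]
    exact neg_eq_of_add_eq_zero_right h
  · have h := congrArg WithLp.snd huv
    rw [hTf]
    exact h

/-- In a quasi Gelfand triple `(H₊, H₀, H₋)` with embeddings `ι₊`, `ι₋`, one has
`ran ι₊ + ran ι₋ = H₀`: every `x ∈ H₀` can be written `x = ι₊ f + ι₋ g`. -/
theorem stmt12 {Hp H0 Hm : Type*}
    [NormedAddCommGroup Hp] [InnerProductSpace ℂ Hp] [CompleteSpace Hp]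
    [NormedAddCommGroup H0] [InnerProductSpace ℂ H0] [CompleteSpace H0]
    [NormedAddCommGroup Hm] [InnerProductSpace ℂ Hm] [CompleteSpace Hm]
    (Ψ : Hm ≃ₗᵢ[ℂ] Hp)
    (ιp : Hp →ₗ.[ℂ] H0) (ιm : Hm →ₗ.[ℂ] H0)
    (hpDense : Dense (ιp.domain : Set Hp))
    (hmDense : Dense (ιm.domain : Set Hm))
    (hpClosed : ιp.IsClosed) (hmClosed : ιm.IsClosed)
    (hpInj : ∀ x y : ιp.domain, ιp x = ιp y → (x : Hp) = (y : Hp))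
    (hmInj : ∀ x y : ιm.domain, ιm x = ιm y → (x : Hm) = (y : Hm))
    (hpRan : Dense (Set.range fun f : ιp.domain => ιp f))
    (hmRan : Dense (Set.range fun g : ιm.domain => ιm g))
    (compat : ∀ (f : ιp.domain) (g : ιm.domain),
      (⟪ιp f, ιm g⟫_ℂ) = ⟪(f : Hp), Ψ (g : Hm)⟫_ℂ)
    (hquasi : ((ιp†).domain : Set H0) = Set.range fun g : ιm.domain => ιm g) :
    ∀ x : H0, ∃ (f : ιp.domain) (g : ιm.domain), x = ιp f + ιm g := by
  intro x
  obtain ⟨f, y, hy, hx⟩ := hpClosed.exists_eq_add_mem_adjoint_domain x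
  rw [← SetLike.mem_coe, hquasi] at hy
  obtain ⟨g, rfl⟩ := hy
  exact ⟨f, g, hx⟩
end

section
/- Let (H₊, H₀, H₋) be a quasi Gelfand triple of Hilbert spaces with embeddings ι₊, ι₋ and unitary Ψ. Suppose f ∈ H₊ and g ∈ H₋ satisfy ⟨f, Ψ(ι₋⁻¹ z)⟩_{H₊} = ⟨Ψ g, ι₊⁻¹ z⟩_{H₊} for all z ∈ ran ι₊ ∩ ran ι₋. Then f ∈ dom ι₊, g ∈ dom ι₋, and ι₊ f = ι₋ g (so this common value lies in ran ι₊ ∩ ran ι₋). -/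
open scoped InnerProductSpace LinearPMap

/-- For a closed operator `T`, every vector `w` decomposes as `w = u + p`, where `u ∈ dom T` and `p`
represents the functional `x ↦ ⟪T u, T x⟫`; that is, `1 + T†T` is surjective. -/
theorem LinearPMap.IsClosed.exists_add_eq_inner_eq {E F : Type*}
    [NormedAddCommGroup E] [InnerProductSpace ℂ E] [CompleteSpace E]
    [NormedAddCommGroup F] [InnerProductSpace ℂ F] [CompleteSpace F]
    {T : E →ₗ.[ℂ] F} (hT : T.IsClosed) (w : E) :
    ∃ (u : T.domain) (p : E), (u : E) + p = w ∧ ∀ x : T.domain, ⟪p, (x : E)⟫_ℂ = ⟪T u, T x⟫_ℂ := by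
  let G : Submodule ℂ (WithLp 2 (E × F)) :=
    T.graph.comap (WithLp.linearEquiv 2 ℂ (E × F)).toLinearMap
  have hG : _root_.IsClosed (G : Set (WithLp 2 (E × F))) :=
    _root_.IsClosed.preimage (WithLp.prod_continuous_ofLp 2 E F) hT
  have : CompleteSpace G := hG.completeSpace_coe
  obtain ⟨a, ha, b, hb, hab⟩ :=
    G.exists_add_mem_mem_orthogonal (WithLp.toLp 2 ((w, 0) : E × F))
  obtain ⟨u, hu, hTu⟩ := (LinearPMap.mem_graph_iff T).1 (show a.ofLp ∈ T.graph from ha)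
  have h1 : w = a.fst + b.fst := congrArg (fun z => z.fst) hab
  have h2 : (0 : F) = a.snd + b.snd := congrArg (fun z => z.snd) hab
  have hu' : (u : E) = a.fst := hu
  have hTu' : T u = a.snd := hTu
  refine ⟨u, b.fst, by rw [h1, hu'], fun x => ?_⟩
  have hx : WithLp.toLp 2 ((x : E), T x) ∈ G := T.mem_graph x
  have h3 := (Submodule.mem_orthogonal' G b).1 hb _ hx
  rw [WithLp.prod_inner_apply] at h3
  have hb2 : b.snd = -T u := by rw [hTu']; exact (neg_eq_of_add_eq_zero_right h2.symm).symm
  change ⟪b.fst, (x : E)⟫_ℂ + ⟪b.snd, T x⟫_ℂ = 0 at h3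
  rwa [hb2, inner_neg_left, add_neg_eq_zero] at h3

/-- Let `(H₊, H₀, H₋)` be a quasi Gelfand triple with embeddings `ι₊`, `ι₋` and
unitary `Ψ`.  If `f ∈ H₊` and `g ∈ H₋` satisfy
`⟨f, Ψ(ι₋⁻¹ z)⟩_{H₊} = ⟨Ψ g, ι₊⁻¹ z⟩_{H₊}` for all `z ∈ ran ι₊ ∩ ran ι₋` (each such `z` being
written `z = ι₊ u = ι₋ v`), then `f ∈ dom ι₊`, `g ∈ dom ι₋` and `ι₊ f = ι₋ g`. -/
theorem stmt13 {Hp H0 Hm : Type*}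
    [NormedAddCommGroup Hp] [InnerProductSpace ℂ Hp] [CompleteSpace Hp]
    [NormedAddCommGroup H0] [InnerProductSpace ℂ H0] [CompleteSpace H0]
    [NormedAddCommGroup Hm] [InnerProductSpace ℂ Hm] [CompleteSpace Hm]
    (Ψ : Hm ≃ₗᵢ[ℂ] Hp)
    (ιp : Hp →ₗ.[ℂ] H0) (ιm : Hm →ₗ.[ℂ] H0)
    (hpDense : Dense (ιp.domain : Set Hp))
    (hmDense : Dense (ιm.domain : Set Hm))
    (hpClosed : ιp.IsClosed) (hmClosed : ιm.IsClosed)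
    (hpInj : ∀ x y : ιp.domain, ιp x = ιp y → (x : Hp) = (y : Hp))
    (hmInj : ∀ x y : ιm.domain, ιm x = ιm y → (x : Hm) = (y : Hm))
    (hpRan : Dense (Set.range fun f : ιp.domain => ιp f))
    (hmRan : Dense (Set.range fun g : ιm.domain => ιm g))
    (compat : ∀ (f : ιp.domain) (g : ιm.domain),
      (⟪ιp f, ιm g⟫_ℂ) = ⟪(f : Hp), Ψ (g : Hm)⟫_ℂ)
    (hquasi : ((ιp†).domain : Set H0) = Set.range fun g : ιm.domain => ιm g)
    (f : Hp) (g : Hm)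
    (hfg : ∀ (u : ιp.domain) (v : ιm.domain), ιp u = ιm v →
      (⟪Ψ (v : Hm), f⟫_ℂ) = ⟪(u : Hp), Ψ g⟫_ℂ) :
    ∃ (hf : f ∈ ιp.domain) (hg : g ∈ ιm.domain), ιp ⟨f, hf⟩ = ιm ⟨g, hg⟩ := by
  have key : ∀ w : Hp, ∃ (u : ιp.domain) (v : ιm.domain),
      ιp u = ιm v ∧ (u : Hp) + Ψ (v : Hm) = w := by
    intro w
    obtain ⟨u, p, hw, hp⟩ := hpClosed.exists_add_eq_inner_eq w
    have hu : ιp u ∈ ((ιp†).domain : Set H0) :=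
      LinearPMap.mem_adjoint_domain_of_exists _ ⟨p, hp⟩
    rw [hquasi] at hu
    obtain ⟨v, hv⟩ := hu
    refine ⟨u, v, hv.symm, ?_⟩
    have hpv : p = Ψ (v : Hm) := by
      refine hpDense.eq_of_inner_right (𝕜 := ℂ) fun x hx => ?_
      rw [← compat ⟨x, hx⟩ v, ← inner_conj_symm, hp ⟨x, hx⟩, inner_conj_symm]
      exact congrArg _ hv.symm
    rw [← hpv, hw]
  obtain ⟨u₀, v₀, huv₀, hw₀⟩ := key (f + Ψ g)
  have hf : f = u₀ := by
    refine ext_inner_left ℂ fun w => ?_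
    obtain ⟨u, v, huv, rfl⟩ := key w
    have hsymm : ⟪Ψ (v : Hm), (u₀ : Hp)⟫_ℂ = ⟪(u : Hp), Ψ (v₀ : Hm)⟫_ℂ := by
      rw [← compat u v₀, ← inner_conj_symm, ← compat u₀ v, inner_conj_symm, huv, huv₀]
    rw [inner_add_left, inner_add_left, hfg u v huv, hsymm, ← inner_add_right, ← inner_add_right,
      hw₀]
  subst hf
  obtain rfl : (v₀ : Hm) = g := Ψ.injective (add_left_cancel hw₀)
  exact ⟨u₀.2, v₀.2, huv₀⟩
end

section
/- Let H₀ be a complex Hilbert space and G : dom G ⊆ H₀ → H₀ a densely defined, self-adjoint, positive, injective linear operator with dense range. Then there exist a complex Hilbert space H₊ and a densely defined, closed, injective linear operator ι₊ : dom ι₊ ⊆ H₊ → H₀ with dense range such that the composition ι₊ ∘ ι₊ᴴ (a densely defined injective operator on H₀) satisfies (ι₊ ∘ ι₊ᴴ)⁻¹ = G, i.e., G is the Gram operator of the quasi Gelfand triple determined by ι₊. -/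
open scoped InnerProductSpace LinearPMap

section HelperLemmas

variable {H : Type*} [NormedAddCommGroup H] [InnerProductSpace ℂ H]

theorem ContinuousLinearMap.commute_apply {B C : H →L[ℂ] H} (hBC : Commute B C) (x : H) :
    B (C x) = C (B x) :=
  congrArg (fun T : H →L[ℂ] H => T x) hBC.eq

theorem norm_le_norm_add_of_re_inner_nonneg {x y : H} (h : 0 ≤ (⟪x, y⟫_ℂ).re) :
    ‖x‖ ≤ ‖x + y‖ ∧ ‖y‖ ≤ ‖x + y‖ := by
  have h1 := norm_add_sq (𝕜 := ℂ) x y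
  rw [RCLike.re_to_complex] at h1
  constructor <;> refine (sq_le_sq₀ (norm_nonneg _) (norm_nonneg _)).mp ?_ <;>
    nlinarith [sq_nonneg ‖x‖, sq_nonneg ‖y‖]

variable [CompleteSpace H]

theorem IsSelfAdjoint.dense_range_of_injective {B : H →L[ℂ] H} (hB : IsSelfAdjoint B)
    (hinj : Function.Injective B) : Dense (Set.range B) := by
  have h : B.rangeᗮ = ⊥ := by
    rw [ContinuousLinearMap.orthogonal_range, hB.adjoint_eq]
    exact LinearMap.ker_eq_bot.mpr hinj
  exact Submodule.dense_iff_topologicalClosure_eq_top.mpr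
    (Submodule.topologicalClosure_eq_top_iff.mpr h)

open scoped ComplexOrder in
/-- The resolvent `S = (1 + G)⁻¹` of a positive self-adjoint operator `G`. -/
theorem LinearPMap.exists_resolvent {G : H →ₗ.[ℂ] H} (hG : IsSelfAdjoint G)
    (hPos : ∀ x : G.domain, 0 ≤ (⟪(x : H), G x⟫_ℂ).re ∧ (⟪(x : H), G x⟫_ℂ).im = 0) :
    ∃ S : H →L[ℂ] H, 0 ≤ S ∧ 0 ≤ 1 - S ∧ (∀ x y, (x, y) ∈ G.graph ↔ S (x + y) = x) ∧
      ∀ z, (S z, z - S z) ∈ G.graph := by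
  have hPos' : ∀ p ∈ G.graph, 0 ≤ (⟪p.1, p.2⟫_ℂ).re := by
    rintro ⟨x, y⟩ hp
    obtain ⟨x', rfl, rfl⟩ := (G.mem_graph_iff).mp hp
    exact (hPos x').1
  let f : G.graph →L[ℂ] H :=
    (ContinuousLinearMap.fst ℂ H H + ContinuousLinearMap.snd ℂ H H).comp G.graph.subtypeL
  have hf : ∀ p : G.graph, f p = p.1.1 + p.1.2 := fun _ => rfl
  have : CompleteSpace G.graph := hG.isClosed.completeSpace_coe
  have hanti : AntilipschitzWith 1 f := by
    refine AddMonoidHomClass.antilipschitz_of_bound f fun p => ?_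
    have := norm_le_norm_add_of_re_inner_nonneg (hPos' p.1 p.2)
    simpa [hf, Prod.norm_def] using this
  have hclosed : _root_.IsClosed (f.range : Set H) := by
    exact hanti.isClosed_range f.uniformContinuous
  have : CompleteSpace f.range := hclosed.completeSpace_coe
  have hrange : f.range = ⊤ := by
    rw [← Submodule.orthogonal_eq_bot_iff, Submodule.eq_bot_iff]
    intro z hz
    have key : ∀ x : G.domain, ⟪-z, (x : H)⟫_ℂ = ⟪z, G x⟫_ℂ := fun x => by
      have h := (Submodule.mem_orthogonal' _ _).mp hz _ ⟨⟨_, G.mem_graph x⟩, rfl⟩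
      simp only [ContinuousLinearMap.coe_coe, hf, inner_add_right] at h
      rw [inner_neg_left]
      linear_combination -h
    have hmem : z ∈ (G†).domain := LinearPMap.mem_adjoint_domain_of_exists z ⟨-z, key⟩
    have hgraph : (z, -z) ∈ (G†).graph :=
      (G†).mem_graph_iff.mpr ⟨⟨z, hmem⟩, rfl, LinearPMap.adjoint_apply_eq hG.dense_domain _ key⟩
    rw [LinearPMap.isSelfAdjoint_def.mp hG] at hgraph
    have h := hPos' _ hgraph
    rw [inner_neg_right, inner_self_eq_norm_sq_to_K] at h
    norm_cast at h
    simp only [Complex.ofReal_re, Complex.coe_algebraMap] at h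
    have : ‖z‖ = 0 := by nlinarith [sq_nonneg ‖z‖]
    exact norm_eq_zero.mp this
  let e := ContinuousLinearEquiv.ofBijective f (LinearMap.ker_eq_bot.mpr hanti.injective) hrange
  have he : ∀ z, (e.symm z).1.1 + (e.symm z).1.2 = z := fun z => e.apply_symm_apply z
  let S : H →L[ℂ] H :=
    ((ContinuousLinearMap.fst ℂ H H).comp G.graph.subtypeL).comp (e.symm : H →L[ℂ] G.graph)
  have hS : ∀ z, S z = (e.symm z).1.1 := fun _ => rfl
  have hgraph : ∀ z, (S z, z - S z) ∈ G.graph := fun z => by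
    have : (S z, z - S z) = (e.symm z).1 :=
      Prod.ext (hS z) (by rw [hS, sub_eq_iff_eq_add']; exact (he z).symm)
    rw [this]
    exact (e.symm z).2
  have hnonneg : ∀ p ∈ G.graph, 0 ≤ ⟪p.1, p.2⟫_ℂ := by
    rintro ⟨x, y⟩ hp
    obtain ⟨x', rfl, rfl⟩ := G.mem_graph_iff.mp hp
    exact Complex.nonneg_iff.mpr ⟨(hPos x').1, (hPos x').2.symm⟩
  have hself : ∀ z : H, 0 ≤ ⟪z, z⟫_ℂ := fun z => by
    rw [inner_self_eq_norm_sq_to_K]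
    norm_cast
    positivity
  have hsymm : ∀ z, 0 ≤ ⟪z - S z, S z⟫_ℂ := fun z => by
    rw [← inner_conj_symm]
    exact star_nonneg_iff.mpr (hnonneg _ (hgraph z))
  have hpositive : ∀ T : H →L[ℂ] H, (∀ z, 0 ≤ ⟪T z, z⟫_ℂ) → 0 ≤ T := fun T h => by
    rw [ContinuousLinearMap.nonneg_iff_isPositive, ContinuousLinearMap.isPositive_iff_complex]
    intro z
    have hz := Complex.nonneg_iff.mp (h z)
    exact ⟨Complex.ext (by simp) (by simpa using hz.2), hz.1⟩
  have hS0 : 0 ≤ S := hpositive S fun z => by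
    have : ⟪S z, z⟫_ℂ = ⟪S z, S z⟫_ℂ + ⟪S z, z - S z⟫_ℂ := by
      rw [← inner_add_right, add_sub_cancel]
    rw [this]
    exact add_nonneg (hself _) (hnonneg _ (hgraph z))
  have hS1 : 0 ≤ 1 - S := hpositive (1 - S) fun z => by
    have : ⟪(1 - S) z, z⟫_ℂ = ⟪z - S z, S z⟫_ℂ + ⟪z - S z, z - S z⟫_ℂ := by
      rw [← inner_add_right, add_sub_cancel]
      rfl
    rw [this]
    exact add_nonneg (hsymm z) (hself _)
  refine ⟨S, hS0, hS1, fun x y => ⟨fun h => ?_, fun h => ?_⟩, hgraph⟩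
  · have : e.symm (x + y) = ⟨(x, y), h⟩ := e.symm_apply_apply ⟨(x, y), h⟩
    rw [hS, this]
  · simpa [h] using hgraph (x + y)

/-- Commuting injective self-adjoint operators with `B² + C² = 1` determine the self-adjoint
operator `C B⁻¹`. -/
theorem exists_selfAdjoint_quotient {B C : H →L[ℂ] H} (hB : IsSelfAdjoint B)
    (hC : IsSelfAdjoint C) (hBC : Commute B C) (hBinj : Function.Injective B)
    (hsq : ∀ x, B (B x) + C (C x) = x) :
    ∃ T : H →ₗ.[ℂ] H, IsSelfAdjoint T ∧ (∀ x y, (x, y) ∈ T.graph ↔ C x = B y) := by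
  let g : H × H →L[ℂ] H :=
    C.comp (ContinuousLinearMap.fst ℂ H H) - B.comp (ContinuousLinearMap.snd ℂ H H)
  have hg : ∀ x y, (x, y) ∈ g.ker ↔ C x = B y := fun x y => by
    simp [g, sub_eq_zero]
  have hcomm := ContinuousLinearMap.commute_apply hBC
  let T := g.ker.toLinearPMap
  have hT : ∀ x y, (x, y) ∈ T.graph ↔ C x = B y := fun x y => by
    rw [Submodule.toLinearPMap_graph_eq, hg]
    rintro ⟨a, b⟩ hab rfl
    rw [hg, map_zero] at hab
    exact hBinj (by rw [← hab, map_zero])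
  have hdense : Dense (T.domain : Set H) := by
    refine (hB.dense_range_of_injective hBinj).mono ?_
    rintro _ ⟨u, rfl⟩
    exact LinearPMap.mem_domain_of_mem_graph ((hT (B u) (C u)).mpr (hcomm u).symm)
  refine ⟨T, LinearPMap.isSelfAdjoint_def.mpr (LinearPMap.eq_of_eq_graph ?_), hT⟩
  rw [LinearPMap.adjoint_graph_eq_graph_adjoint hdense]
  ext ⟨y, w⟩
  rw [Submodule.mem_adjoint_iff, hT]
  have hBs := hB.isSymmetric
  have hCs := hC.isSymmetric
  constructor
  · intro h
    refine ext_inner_left ℂ fun u => ?_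
    have := h (B u) (C u) ((hT _ _).mpr (hcomm u).symm)
    rw [sub_eq_zero] at this
    exact (hCs u y).symm.trans (this.trans (hBs u w))
  · intro h a b hab
    rw [hT] at hab
    have ha : B (B a + C b) = a := by rw [map_add, hcomm, ← hab, hsq]
    have hb : C (B a + C b) = b := by rw [map_add, ← hcomm, hab, hsq]
    have key : ∀ u, ⟪C u, y⟫_ℂ = ⟪B u, w⟫_ℂ := fun u =>
      (hCs u y).trans ((congrArg _ h).trans (hBs u w).symm)
    have := key (B a + C b)
    rwa [ha, hb, ← sub_eq_zero] at this

end HelperLemmas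

/-- Let `H₀` be a complex Hilbert space and `G` a densely defined, self-adjoint
(`Gᴴ = G`), positive, injective operator on `H₀` with dense range.  Then there are a complex
Hilbert space `H₊` and a densely defined, closed, injective operator `ι₊ : dom ι₊ ⊆ H₊ → H₀` with
dense range such that `(ι₊ ∘ ι₊ᴴ)⁻¹ = G` (equality of graphs: `y = G x ⟺ x = ι₊(ι₊ᴴ y)`), i.e.
`G` is the Gram operator of the quasi Gelfand triple determined by `ι₊`. -/
theorem stmt15 {H0 : Type u}
    [NormedAddCommGroup H0] [InnerProductSpace ℂ H0] [CompleteSpace H0]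
    (G : H0 →ₗ.[ℂ] H0)
    (hDense : Dense (G.domain : Set H0))
    (hSelfAdjoint : G† = G)
    (hPos : ∀ x : G.domain, 0 ≤ (⟪(x : H0), G x⟫_ℂ).re ∧ (⟪(x : H0), G x⟫_ℂ).im = 0)
    (hInj : ∀ x y : G.domain, G x = G y → (x : H0) = (y : H0))
    (hRan : Dense (Set.range fun x : G.domain => G x)) :
    ∃ (Hp : Type u) (_ : NormedAddCommGroup Hp) (_ : InnerProductSpace ℂ Hp)
      (_ : CompleteSpace Hp) (ιp : Hp →ₗ.[ℂ] H0),
      Dense (ιp.domain : Set Hp) ∧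
      ιp.IsClosed ∧
      (∀ x y : ιp.domain, ιp x = ιp y → (x : Hp) = (y : Hp)) ∧
      Dense (Set.range fun f : ιp.domain => ιp f) ∧
      ∀ x y : H0, (x, y) ∈ G.graph ↔
        ∃ (hy : y ∈ (ιp†).domain) (hz : ιp† ⟨y, hy⟩ ∈ ιp.domain),
          ιp ⟨ιp† ⟨y, hy⟩, hz⟩ = x := by
  have hG : IsSelfAdjoint G := LinearPMap.isSelfAdjoint_def.mpr hSelfAdjoint
  obtain ⟨S, hS0, hS1, hS, hSmem⟩ := LinearPMap.exists_resolvent hG hPos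
  have hSker : ∀ z, S z = 0 → z = 0 := fun z hz => by
    have := hSmem z
    rw [hz, sub_zero] at this
    exact G.graph_fst_eq_zero_snd this rfl
  have hSker' : ∀ z, z - S z = 0 → z = 0 := fun z hz => by
    have h := hSmem z
    rw [hz] at h
    obtain ⟨x, hx, hx0⟩ := G.mem_graph_iff.mp h
    have : (x : H0) = 0 := hInj x 0 (hx0.trans G.map_zero.symm)
    rw [← sub_add_cancel z (S z), hz, zero_add]
    exact hx.symm.trans this
  let C := CFC.sqrt S
  let B := CFC.sqrt (1 - S)
  have hC : IsSelfAdjoint C := (CFC.sqrt_nonneg S).isSelfAdjoint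
  have hB : IsSelfAdjoint B := (CFC.sqrt_nonneg (1 - S)).isSelfAdjoint
  have hCC : ∀ x, C (C x) = S x := fun x =>
    congrArg (fun T : H0 →L[ℂ] H0 => T x) (CFC.sqrt_mul_sqrt_self S hS0)
  have hBB : ∀ x, B (B x) = x - S x := fun x =>
    congrArg (fun T : H0 →L[ℂ] H0 => T x) (CFC.sqrt_mul_sqrt_self (1 - S) hS1)
  have hBC : Commute B C := by
    have h : Commute (1 - S) S := (Commute.one_left S).sub_left (Commute.refl S)
    exact ((h.cfcₙ_nnreal NNReal.sqrt).symm.cfcₙ_nnreal NNReal.sqrt).symm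
  have hcomm := ContinuousLinearMap.commute_apply hBC
  have hBinj : Function.Injective B := (injective_iff_map_eq_zero B).mpr fun x hx =>
    hSker' x (by rw [← hBB, hx, map_zero])
  have hCinj : Function.Injective C := (injective_iff_map_eq_zero C).mpr fun x hx =>
    hSker x (by rw [← hCC, hx, map_zero])
  have hsq : ∀ x, B (B x) + C (C x) = x := fun x => by rw [hBB, hCC, sub_add_cancel]
  obtain ⟨T, hT, hTgraph⟩ := exists_selfAdjoint_quotient hB hC hBC hBinj hsq
  refine ⟨H0, inferInstance, inferInstance, inferInstance, T, hT.dense_domain, hT.isClosed,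
    fun x y hxy => hCinj ?_, ?_, fun x y => ?_⟩
  · rw [(hTgraph _ _).mp (T.mem_graph x), (hTgraph _ _).mp (T.mem_graph y), hxy]
  · refine (hC.dense_range_of_injective hCinj).mono ?_
    rintro _ ⟨u, rfl⟩
    exact LinearPMap.mem_range_iff.mpr ⟨B u, (hTgraph _ _).mpr (hcomm u).symm⟩
  · rw [LinearPMap.isSelfAdjoint_def.mp hT, hS]
    have hiff : S (x + y) = x ↔ C (C y) = B (B x) := by
      rw [hCC, hBB, map_add, eq_sub_iff_add_eq']
    rw [hiff]
    constructor
    · intro h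
      have hyw : (y, C (B (x + y))) ∈ T.graph := by
        rw [hTgraph, hcomm, map_add, map_add, ← h, map_add, add_comm, ← hcomm, ← hcomm, hsq]
      have hwx : (C (B (x + y)), x) ∈ T.graph := by
        rw [hTgraph, ← hcomm, ← hcomm, map_add, map_add, h, add_comm, hsq]
      obtain ⟨⟨y', hy⟩, rfl, hyT⟩ := T.mem_graph_iff.mp hyw
      obtain ⟨⟨w, hw⟩, hwx', hwT⟩ := T.mem_graph_iff.mp hwx
      dsimp only at hyT hwT hwx'
      subst hwx'
      refine ⟨hy, hyT ▸ hw, ?_⟩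
      exact (congrArg T (Subtype.ext hyT)).trans hwT
    · rintro ⟨hy, hz, hx⟩
      have h1 := (hTgraph _ _).mp (T.mem_graph ⟨y, hy⟩)
      have h2 := (hTgraph _ _).mp (T.mem_graph ⟨_, hz⟩)
      rw [hx] at h2
      rw [h1, ← hcomm, h2]
end

section
/- Let (H₊, H₀, H₋) be a quasi Gelfand triple of Hilbert spaces with embeddings ι₊, ι₋, and define the Gram operators G₊ := (ι₊ ∘ ι₊ᴴ)⁻¹ and G₋ := (ι₋ ∘ ι₋ᴴ)⁻¹, both densely defined injective operators on H₀. Then G₋ = G₊⁻¹, i.e., ι₋ ∘ ι₋ᴴ = (ι₊ ∘ ι₊ᴴ)⁻¹ as partial operators on H₀ (equality of graphs). -/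
open scoped InnerProductSpace LinearPMap

namespace LinearPMap

variable {𝕜 E F : Type*} [RCLike 𝕜]
  [NormedAddCommGroup E] [InnerProductSpace 𝕜 E] [CompleteSpace E]
  [NormedAddCommGroup F] [InnerProductSpace 𝕜 F]

/-- The graph of a densely defined closed operator contains every pair that is orthogonal, in the
twisted sense, to the graph of the adjoint; that is, `T†† ≤ T`. -/
theorem IsClosed.mem_graph_of_forall_adjoint [CompleteSpace F] {T : E →ₗ.[𝕜] F}
    (hT : T.IsClosed) (hd : Dense (T.domain : Set E)) {w : E} {x : F}
    (h : ∀ z : T†.domain, ⟪T† z, w⟫_𝕜 = ⟪(z : F), x⟫_𝕜) : (w, x) ∈ T.graph := by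
  let e := WithLp.linearEquiv 2 𝕜 (E × F)
  let K : Submodule 𝕜 (WithLp 2 (E × F)) := T.graph.comap e.toLinearMap
  have hK : _root_.IsClosed (K : Set (WithLp 2 (E × F))) :=
    _root_.IsClosed.preimage (WithLp.prod_continuous_ofLp 2 E F) hT
  suffices hmem : WithLp.toLp 2 (w, x) ∈ K from hmem
  rw [← hK.submodule_topologicalClosure_eq, ← Submodule.orthogonal_orthogonal_eq_closure,
    Submodule.mem_orthogonal]
  intro v hv
  have hv' : ∀ f : T.domain, ⟪-v.fst, (f : E)⟫_𝕜 = ⟪v.snd, T f⟫_𝕜 := fun f => by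
    have := (Submodule.mem_orthogonal' _ _).1 hv (WithLp.toLp 2 ((f : E), T f)) (T.mem_graph f)
    rw [WithLp.prod_inner_apply] at this
    rw [inner_neg_left]
    exact neg_eq_of_add_eq_zero_right this
  have hdom : v.snd ∈ T†.domain := mem_adjoint_domain_of_exists _ ⟨_, hv'⟩
  have hz := h ⟨v.snd, hdom⟩
  rw [adjoint_apply_eq hd ⟨v.snd, hdom⟩ hv', inner_neg_left] at hz
  rw [WithLp.prod_inner_apply]
  change ⟪v.fst, w⟫_𝕜 + ⟪v.snd, x⟫_𝕜 = 0
  rw [← hz, add_neg_cancel]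

end LinearPMap

/-- In a quasi Gelfand triple `(H₊, H₀, H₋)` with embeddings `ι₊`, `ι₋`, the Gram
operators `G₊ = (ι₊ ∘ ι₊ᴴ)⁻¹` and `G₋ = (ι₋ ∘ ι₋ᴴ)⁻¹` satisfy `G₋ = G₊⁻¹`, i.e.
`ι₋ ∘ ι₋ᴴ = (ι₊ ∘ ι₊ᴴ)⁻¹` as partial operators on `H₀` (equality of graphs):
`y = ι₋(ι₋ᴴ x)` holds iff `x = ι₊(ι₊ᴴ y)`. -/
theorem stmt16 {Hp H0 Hm : Type*}
    [NormedAddCommGroup Hp] [InnerProductSpace ℂ Hp] [CompleteSpace Hp]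
    [NormedAddCommGroup H0] [InnerProductSpace ℂ H0] [CompleteSpace H0]
    [NormedAddCommGroup Hm] [InnerProductSpace ℂ Hm] [CompleteSpace Hm]
    (Ψ : Hm ≃ₗᵢ[ℂ] Hp)
    (ιp : Hp →ₗ.[ℂ] H0) (ιm : Hm →ₗ.[ℂ] H0)
    (hpDense : Dense (ιp.domain : Set Hp))
    (hmDense : Dense (ιm.domain : Set Hm))
    (hpClosed : ιp.IsClosed) (hmClosed : ιm.IsClosed)
    (hpInj : ∀ x y : ιp.domain, ιp x = ιp y → (x : Hp) = (y : Hp))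
    (hmInj : ∀ x y : ιm.domain, ιm x = ιm y → (x : Hm) = (y : Hm))
    (hpRan : Dense (Set.range fun f : ιp.domain => ιp f))
    (hmRan : Dense (Set.range fun g : ιm.domain => ιm g))
    (compat : ∀ (f : ιp.domain) (g : ιm.domain),
      (⟪ιp f, ιm g⟫_ℂ) = ⟪(f : Hp), Ψ (g : Hm)⟫_ℂ)
    (hquasi : ((ιp†).domain : Set H0) = Set.range fun g : ιm.domain => ιm g) :
    ∀ x y : H0,
      (∃ (hx : x ∈ (ιm†).domain) (hx2 : ιm† ⟨x, hx⟩ ∈ ιm.domain),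
          ιm ⟨ιm† ⟨x, hx⟩, hx2⟩ = y) ↔
      (∃ (hy : y ∈ (ιp†).domain) (hy2 : ιp† ⟨y, hy⟩ ∈ ιp.domain),
          ιp ⟨ιp† ⟨y, hy⟩, hy2⟩ = x) := by
  have adjp : ∀ (g : ιm.domain) (hg : ιm g ∈ (ιp†).domain), ιp† ⟨ιm g, hg⟩ = Ψ (g : Hm) :=
    fun g hg => LinearPMap.adjoint_apply_eq hpDense _ fun f => by
      rw [← inner_conj_symm, ← compat f g, inner_conj_symm]
  have compat' : ∀ (f : ιp.domain) (g : ιm.domain),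
      ⟪Ψ.symm (f : Hp), (g : Hm)⟫_ℂ = ⟪ιp f, ιm g⟫_ℂ := fun f g => by
    rw [compat f g, ← Ψ.inner_map_map, Ψ.apply_symm_apply]
  have mem_ran : ∀ y ∈ (ιp†).domain, ∃ g : ιm.domain, ιm g = y := fun y hy => by
    have hy' : y ∈ ((ιp†).domain : Set H0) := hy
    rwa [hquasi] at hy'
  have ran_mem : ∀ g : ιm.domain, ιm g ∈ (ιp†).domain := fun g => by
    have hg : ιm g ∈ Set.range fun g : ιm.domain => ιm g := ⟨g, rfl⟩
    rwa [← hquasi] at hg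
  intro x y
  constructor
  · rintro ⟨hx, hx2, rfl⟩
    have hgraph : (Ψ (ιm† ⟨x, hx⟩), x) ∈ ιp.graph := by
      refine hpClosed.mem_graph_of_forall_adjoint hpDense ?_
      rintro ⟨z, hz⟩
      obtain ⟨g, rfl⟩ := mem_ran z hz
      rw [adjp, Ψ.inner_map_map]
      exact ((LinearPMap.adjoint_isFormalAdjoint hmDense).symm g ⟨x, hx⟩).symm
    obtain ⟨f, hf, hfx⟩ := (LinearPMap.mem_graph_iff _).1 hgraph
    have key := adjp ⟨_, hx2⟩ (ran_mem _)
    have hdom : ιp† ⟨_, ran_mem ⟨_, hx2⟩⟩ ∈ ιp.domain := by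
      rw [key]
      exact Set.mem_of_eq_of_mem hf.symm f.2
    exact ⟨ran_mem _, hdom, (congrArg ιp (Subtype.ext (key.trans hf.symm))).trans hfx⟩
  · rintro ⟨hy, hy2, rfl⟩
    obtain ⟨g, rfl⟩ := mem_ran y hy
    have hdom : ιp ⟨_, hy2⟩ ∈ (ιm†).domain :=
      LinearPMap.mem_adjoint_domain_of_exists _ ⟨_, compat' ⟨_, hy2⟩⟩
    have key : ιm† ⟨_, hdom⟩ = (g : Hm) := by
      rw [LinearPMap.adjoint_apply_eq hmDense ⟨_, hdom⟩ (compat' ⟨_, hy2⟩)]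
      simp only [adjp, Ψ.symm_apply_apply]
    have hdom2 : ιm† ⟨_, hdom⟩ ∈ ιm.domain := key ▸ g.2
    exact ⟨hdom, hdom2, congrArg ιm (Subtype.ext key)⟩
end

section
/- Let (H₊, H₀, H₋) be a quasi Gelfand triple of Hilbert spaces with embeddings ι₊, ι₋. Then there exist closed subspaces V and W of H₀ with W equal to the orthogonal complement of V, such that: (a) W ⊆ ran ι₊ and ‖ι₊⁻¹ w‖_{H₊} ≤ ‖w‖_{H₀} for all w ∈ W; (b) V ∩ ran ι₊ is dense in V, and ‖ι₊ f‖_{H₀} ≤ ‖f‖_{H₊} for every f ∈ dom ι₊ with ι₊ f ∈ V; (c) V ⊆ ran ι₋ and ‖ι₋⁻¹ v‖_{H₋} ≤ ‖v‖_{H₀} for all v ∈ V; (d) W ∩ ran ι₋ is dense in W, and ‖ι₋ g‖_{H₀} ≤ ‖g‖_{H₋} for every g ∈ dom ι₋ with ι₋ g ∈ W; (e) H₊ is the orthogonal direct sum of the closures (in H₊) of ι₊⁻¹(V ∩ ran ι₊) and ι₊⁻¹(W), and H₋ is the orthogonal direct sum of the closures (in H₋) of ι₋⁻¹(W ∩ ran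 ι₋) and ι₋⁻¹(V). In particular, the quasi Gelfand triple decomposes into two ordinary (continuously embedded) Gelfand triples composed cross-wise. -/
open scoped InnerProductSpace LinearPMap

section Orthogonality

variable {E : Type*} [NormedAddCommGroup E] [InnerProductSpace ℂ E] [CompleteSpace E]

theorem Submodule.orthogonal_topologicalClosure_eq {X Y : Submodule ℂ E} (hXY : X ⟂ Y)
    (htotal : Xᗮ ⊓ Yᗮ = ⊥) : X.topologicalClosureᗮ = Y.topologicalClosure := by
  rw [Submodule.orthogonal_closure]
  have hYX : Y.topologicalClosure ≤ Xᗮ :=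
    Y.topologicalClosure_minimal hXY.symm X.isClosed_orthogonal
  refine le_antisymm (fun x hx => ?_) hYX
  have : CompleteSpace Y.topologicalClosure := Y.isClosed_topologicalClosure.completeSpace_coe
  have hmem := Y.topologicalClosure.starProjection_apply_mem x
  have hzero : x - Y.topologicalClosure.starProjection x ∈ Xᗮ ⊓ Yᗮ := by
    refine ⟨Submodule.sub_mem _ hx (hYX hmem), ?_⟩
    rw [← Y.orthogonal_closure]
    exact Submodule.sub_starProjection_mem_orthogonal x
  rw [htotal, Submodule.mem_bot, sub_eq_zero] at hzero
  rw [hzero]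
  exact hmem

theorem Submodule.le_closure_of_inner_eq_zero {K U : Submodule ℂ E} (hU : IsClosed (U : Set E))
    (hKU : K ≤ U) (h : ∀ x ∈ U, (∀ k ∈ K, ⟪k, x⟫_ℂ = 0) → x = 0) :
    U ≤ K.topologicalClosure := by
  intro v hv
  have : CompleteSpace K.topologicalClosure := K.isClosed_topologicalClosure.completeSpace_coe
  have hmem := K.topologicalClosure.starProjection_apply_mem v
  have horth : v - K.topologicalClosure.starProjection v ∈ Kᗮ := by
    rw [← K.orthogonal_closure]
    exact Submodule.sub_starProjection_mem_orthogonal v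
  have hzero := h _ (U.sub_mem hv (K.topologicalClosure_minimal hKU hU hmem))
    ((Submodule.mem_orthogonal _ _).1 horth)
  rw [sub_eq_zero.1 hzero]
  exact hmem

theorem ContinuousLinearMap.IsPositive.apply_mem_orthogonal {L : E →L[ℂ] E} (hL : L.IsPositive)
    {U : Submodule ℂ E} (hLU : ∀ x ∈ U, L x ∈ U) {x : E} (hx : x ∈ Uᗮ) : L x ∈ Uᗮ := by
  rw [Submodule.mem_orthogonal] at hx ⊢
  intro u hu
  rw [← hL.inner_left_eq_inner_right]
  exact hx _ (hLU u hu)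

theorem ContinuousLinearMap.IsPositive.exists_mem_add_apply_eq {L : E →L[ℂ] E}
    (hL : L.IsPositive) {U : Submodule ℂ E} (hU : IsClosed (U : Set E))
    (hLU : ∀ x ∈ U, L x ∈ U) {v : E} (hv : v ∈ U) : ∃ u ∈ U, u + L u = v := by
  have hunit : IsUnit (1 + L) := by
    refine ContinuousLinearMap.isUnit_of_forall_le_norm_inner_map _ (c := 1) one_pos fun x => ?_
    calc ‖x‖ ^ 2 * ((1 : NNReal) : ℝ) ≤ RCLike.re ⟪(1 + L) x, x⟫_ℂ := by
          have h0 := hL.re_inner_nonneg_left x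
          change _ ≤ RCLike.re ⟪x + L x, x⟫_ℂ
          rw [inner_add_left, map_add, inner_self_eq_norm_sq, NNReal.coe_one, mul_one]
          linarith
      _ ≤ ‖⟪(1 + L) x, x⟫_ℂ‖ := RCLike.re_le_norm _
  rw [ContinuousLinearMap.isUnit_iff_bijective] at hunit
  obtain ⟨z, hz⟩ := hunit.2 v
  have : CompleteSpace U := hU.completeSpace_coe
  set u := U.starProjection z
  have hu : u ∈ U := U.starProjection_apply_mem z
  have hz' : z - u ∈ Uᗮ := Submodule.sub_starProjection_mem_orthogonal z
  have hLz' : L (z - u) ∈ Uᗮ := hL.apply_mem_orthogonal hLU hz'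
  have h1 : (1 + L) (z - u) ∈ U := by
    rw [map_sub, hz]
    exact U.sub_mem hv (U.add_mem hu (hLU u hu))
  have h2 : (1 + L) (z - u) ∈ Uᗮ := Uᗮ.add_mem hz' hLz'
  have h3 : (1 + L) (z - u) = 0 :=
    inner_self_eq_zero.1 (Submodule.inner_right_of_mem_orthogonal h1 h2)
  refine ⟨u, hu, ?_⟩
  rw [map_sub, hz, sub_eq_zero] at h3
  exact h3.symm

theorem IsSelfAdjoint.exists_spectral_splitting {D : E →L[ℂ] E} (hD : IsSelfAdjoint D) :
    ∃ (V : Submodule ℂ E) (L : E →L[ℂ] E), IsClosed (V : Set E) ∧ L.IsPositive ∧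
      (∀ x ∈ V, L x ∈ V) ∧ (∀ x ∈ V, D x = L x) ∧ (∀ x ∈ Vᗮ, D x = -L x) := by
  have hMN (x : E) : D⁺ (D⁻ x) = 0 := DFunLike.congr_fun (CFC.posPart_mul_negPart D) x
  have hNM (x : E) : D⁻ (D⁺ x) = 0 := DFunLike.congr_fun (CFC.negPart_mul_posPart D) x
  have hsub (x : E) : D x = D⁺ x - D⁻ x :=
    (DFunLike.congr_fun (CFC.posPart_sub_negPart D hD) x).symm
  have hM : (D⁺).IsPositive :=
    (ContinuousLinearMap.nonneg_iff_isPositive _).1 (CFC.posPart_nonneg D)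
  have hN : (D⁻).IsPositive :=
    (ContinuousLinearMap.nonneg_iff_isPositive _).1 (CFC.negPart_nonneg D)
  have hV : ∀ x ∈ (D⁻).ker, D⁻ x = 0 := fun x hx => hx
  refine ⟨(D⁻).ker, D⁺ + D⁻, (D⁻).isClosed_ker, hM.add hN, fun x hx => ?_, fun x hx => ?_,
    fun x hx => ?_⟩
  · change D⁻ (D⁺ x + D⁻ x) = 0
    rw [hV x hx, add_zero, hNM]
  · rw [hsub, add_apply, hV x hx, sub_zero, add_zero]
  · have hx0 : D⁺ x = 0 := by
      rw [← inner_self_eq_zero (𝕜 := ℂ), ← hM.inner_left_eq_inner_right]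
      exact (Submodule.mem_orthogonal _ _).1 hx _ (hNM (D⁺ x))
    rw [hsub, add_apply, hx0, zero_sub, zero_add]

end Orthogonality

section GelfandTriple

variable {Hp H0 Hm : Type*}
  [NormedAddCommGroup Hp] [InnerProductSpace ℂ Hp] [CompleteSpace Hp]
  [NormedAddCommGroup H0] [InnerProductSpace ℂ H0] [CompleteSpace H0]
  [NormedAddCommGroup Hm] [InnerProductSpace ℂ Hm]

/-- The blocks `A` and `S` of the orthogonal projection onto the graph of a closed operator `T`;
formally `A = T† (1 + T T†)⁻¹` and `S = T T† (1 + T T†)⁻¹`. -/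
theorem LinearPMap.IsClosed.exists_graph_projection_blocks {T : Hp →ₗ.[ℂ] H0} (hT : T.IsClosed)
    (hdense : Dense (T.domain : Set Hp))
    (hinj : ∀ x y : T.domain, T x = T y → (x : Hp) = (y : Hp)) :
    ∃ (A : H0 →L[ℂ] Hp) (S : H0 →L[ℂ] H0), IsSelfAdjoint S ∧
      (∀ y, ∃ f : T.domain, (f : Hp) = A y ∧ T f = S y) ∧
      (∀ y (f : T.domain), ⟪A y, (f : Hp)⟫_ℂ = ⟪y - S y, T f⟫_ℂ) ∧
      (∀ x, (∀ y, ⟪x, A y⟫_ℂ = 0) → x = 0) := by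
  let e := WithLp.prodContinuousLinearEquiv 2 ℂ Hp H0
  let G : Submodule ℂ (WithLp 2 (Hp × H0)) := T.graph.comap (e : WithLp 2 (Hp × H0) →ₗ[ℂ] Hp × H0)
  have hG : _root_.IsClosed (G : Set (WithLp 2 (Hp × H0))) := IsClosed.preimage e.continuous hT
  have : CompleteSpace G := hG.completeSpace_coe
  let P := G.starProjection
  let inr : H0 →L[ℂ] WithLp 2 (Hp × H0) := e.symm.toContinuousLinearMap ∘L .inr ℂ Hp H0
  let A : H0 →L[ℂ] Hp := .fst ℂ Hp H0 ∘L e.toContinuousLinearMap ∘L P ∘L inr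
  let S : H0 →L[ℂ] H0 := .snd ℂ Hp H0 ∘L e.toContinuousLinearMap ∘L P ∘L inr
  have hinr (z : WithLp 2 (Hp × H0)) (y : H0) : ⟪z, inr y⟫_ℂ = ⟪z.snd, y⟫_ℂ := by
    rw [WithLp.prod_inner_apply]
    exact (congrArg (· + _) (inner_zero_right _)).trans (zero_add _)
  have hinr' (z : WithLp 2 (Hp × H0)) (y : H0) : ⟪inr y, z⟫_ℂ = ⟪y, z.snd⟫_ℂ := by
    rw [WithLp.prod_inner_apply]
    exact (congrArg (· + _) (inner_zero_left _)).trans (zero_add _)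
  have hPmem (z) : ∃ f : T.domain, (f : Hp) = (P z).fst ∧ T f = (P z).snd :=
    (LinearPMap.mem_graph_iff T).1 (G.starProjection_apply_mem z)
  have hgraph (f : T.domain) : WithLp.toLp 2 ((f : Hp), T f) ∈ G := T.mem_graph f
  refine ⟨A, S, ?_, fun y => hPmem (inr y), fun y f => ?_, fun x hx => ?_⟩
  · rw [ContinuousLinearMap.isSelfAdjoint_iff_isSymmetric]
    intro y z
    have h := G.inner_starProjection_left_eq_right (inr y) (inr z)
    rwa [hinr, hinr'] at h
  · have h := G.starProjection_inner_eq_zero (inr y) _ (hgraph f)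
    rw [inner_sub_left, hinr', WithLp.prod_inner_apply, sub_eq_zero] at h
    rw [inner_sub_left, eq_sub_iff_add_eq]
    exact h.symm
  · let z : WithLp 2 (Hp × H0) := WithLp.toLp 2 (x, 0)
    have hsnd : (P z).snd = 0 := by
      rw [← inner_self_eq_zero (𝕜 := ℂ), ← hinr, G.inner_starProjection_left_eq_right,
        WithLp.prod_inner_apply]
      refine (congrArg₂ (· + ·) (hx _) (inner_zero_left _)).trans (add_zero 0)
    obtain ⟨c, hc, hTc⟩ := hPmem z
    have hfst : (P z).fst = 0 := by
      rw [← hc]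
      exact hinj c 0 (by rw [hTc, hsnd, LinearPMap.map_zero])
    refine hdense.eq_zero_of_inner_left ℂ fun v hv => ?_
    let f : T.domain := ⟨v, hv⟩
    have h := G.starProjection_inner_eq_zero z _ (hgraph f)
    rw [inner_sub_left, WithLp.prod_inner_apply, WithLp.prod_inner_apply] at h
    change ⟪x, (f : Hp)⟫_ℂ + ⟪(0 : H0), T f⟫_ℂ
      - (⟪(P z).fst, (f : Hp)⟫_ℂ + ⟪(P z).snd, T f⟫_ℂ) = 0 at h
    simpa [hfst, hsnd, f] using h

variable {Ψ : Hm ≃ₗᵢ[ℂ] Hp} {ιp : Hp →ₗ.[ℂ] H0} {ιm : Hm →ₗ.[ℂ] H0}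

/-- A closed subspace `U` on which `R ≥ 1 / 2`, and which reduces `S = 1 - R` and `R`, is contained
in `ran ιm`, and `ιp` restricts to a contractive dense embedding into it. -/
theorem reducing_subspace_properties
    (hpInj : ∀ x y : ιp.domain, ιp x = ιp y → (x : Hp) = (y : Hp))
    (hmInj : ∀ x y : ιm.domain, ιm x = ιm y → (x : Hm) = (y : Hm))
    (compat : ∀ (f : ιp.domain) (g : ιm.domain),
      ⟪ιp f, ιm g⟫_ℂ = ⟪(f : Hp), Ψ (g : Hm)⟫_ℂ)
    {A : H0 →L[ℂ] Hp} {S R L : H0 →L[ℂ] H0} (hS : IsSelfAdjoint S) (hSR : S + R = 1)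
    (hp : ∀ y, ∃ f : ιp.domain, (f : Hp) = A y ∧ ιp f = S y)
    (hm : ∀ y, ∃ g : ιm.domain, Ψ (g : Hm) = A y ∧ ιm g = R y)
    (hA : ∀ x, (∀ y, ⟪x, A y⟫_ℂ = 0) → x = 0)
    {U : Submodule ℂ H0} (hU : IsClosed (U : Set H0)) (hL : L.IsPositive)
    (hLU : ∀ x ∈ U, L x ∈ U) (hUL : ∀ x ∈ U, R x - S x = L x)
    (hUL' : ∀ x ∈ Uᗮ, R x - S x = -L x) :
    ((U : Set H0) ⊆ Set.range (fun g : ιm.domain => ιm g) ∧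
      ∀ g : ιm.domain, ιm g ∈ U → ‖(g : Hm)‖ ≤ ‖ιm g‖) ∧
    ((U : Set H0) ⊆ closure ((U : Set H0) ∩ Set.range (fun f : ιp.domain => ιp f)) ∧
      ∀ f : ιp.domain, ιp f ∈ U → ‖ιp f‖ ≤ ‖(f : Hp)‖) ∧
    ((Submodule.comap ιp.toFun (U ⊓ LinearMap.range ιp.toFun)).map
        ιp.domain.subtype).topologicalClosureᗮ =
      ((Submodule.comap ιp.toFun Uᗮ).map ιp.domain.subtype).topologicalClosure := by
  have hSR' (x : H0) : S x + R x = x := DFunLike.congr_fun hSR x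
  have hLU' (x) (hx : x ∈ Uᗮ) : L x ∈ Uᗮ := hL.apply_mem_orthogonal hLU hx
  have hR_eq (x) (hx : x ∈ U) : R x = (2⁻¹ : ℂ) • (x + L x) := by
    rw [← hUL x hx]
    nth_rw 2 [← hSR' x]
    module
  have hS_eq (x) (hx : x ∈ U) : S x = (2⁻¹ : ℂ) • (x - L x) := by
    rw [← hUL x hx]
    nth_rw 2 [← hSR' x]
    module
  have hS_eq' (x) (hx : x ∈ Uᗮ) : S x = (2⁻¹ : ℂ) • (x + L x) := by
    rw [← neg_neg (L x), ← hUL' x hx]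
    nth_rw 2 [← hSR' x]
    module
  have hSU (x) (hx : x ∈ U) : S x ∈ U := by
    rw [hS_eq x hx]
    exact U.smul_mem _ (U.sub_mem hx (hLU x hx))
  have hSU' (x) (hx : x ∈ Uᗮ) : S x ∈ Uᗮ := by
    rw [hS_eq' x hx]
    exact Uᗮ.smul_mem _ (Uᗮ.add_mem hx (hLU' x hx))
  have hRU' (x) (hx : x ∈ Uᗮ) : R x ∈ Uᗮ := by
    rw [← add_sub_cancel_left (S x) (R x), hSR']
    exact Uᗮ.sub_mem hx (hSU' x hx)
  have hRsurj (v) (hv : v ∈ U) : ∃ u ∈ U, R u = v := by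
    obtain ⟨u, hu, huv⟩ := hL.exists_mem_add_apply_eq hU hLU (U.smul_mem 2 hv)
    exact ⟨u, hu, by rw [hR_eq u hu, huv, inv_smul_smul₀ two_ne_zero]⟩
  have hSsurj (v) (hv : v ∈ Uᗮ) : ∃ u ∈ Uᗮ, S u = v := by
    obtain ⟨u, hu, huv⟩ :=
      hL.exists_mem_add_apply_eq U.isClosed_orthogonal hLU' (Uᗮ.smul_mem 2 hv)
    exact ⟨u, hu, by rw [hS_eq' u hu, huv, inv_smul_smul₀ two_ne_zero]⟩
  have hSinj (x) (hx : S x = 0) : x = 0 := by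
    obtain ⟨f, hfA, hf⟩ := hp x
    obtain ⟨g, hgA, hg⟩ := hm x
    have hf0 : (f : Hp) = 0 := hpInj f 0 (by rw [hf, hx, LinearPMap.map_zero])
    have hg0 : g = 0 := by
      rw [← Submodule.coe_eq_zero, ← Ψ.map_eq_zero_iff, hgA, ← hfA, hf0]
    rw [← hSR' x, hx, ← hg, hg0, LinearPMap.map_zero, add_zero]
  have hrange : (U : Set H0) ⊆ Set.range (fun g : ιm.domain => ιm g) := fun v hv => by
    obtain ⟨u, -, hu⟩ := hRsurj v hv
    obtain ⟨g, -, hg⟩ := hm u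
    exact ⟨g, hg.trans hu⟩
  have hmbound (g : ιm.domain) (hgU : ιm g ∈ U) : ‖(g : Hm)‖ ≤ ‖ιm g‖ := by
    obtain ⟨u, hu, huv⟩ := hRsurj _ hgU
    obtain ⟨g', hgA, hg⟩ := hm u
    obtain ⟨f, hfA, hf⟩ := hp u
    have hgg : (g : Hm) = g' := hmInj _ _ (by rw [hg, huv])
    have hinner : ⟪S u, R u⟫_ℂ = ⟪Ψ (g : Hm), Ψ (g : Hm)⟫_ℂ := by
      rw [← hf, ← hg, compat, hfA, hgg, hgA]
    have hnonneg : 0 ≤ RCLike.re ⟪L u, R u⟫_ℂ := by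
      have hRR : R u + R u = u + L u := by
        rw [← hUL u hu]
        nth_rw 3 [← hSR' u]
        abel
      have h1 : 0 ≤ RCLike.re ⟪L u, u + L u⟫_ℂ := by
        rw [inner_add_right, map_add]
        exact add_nonneg (hL.re_inner_nonneg_left u) inner_self_nonneg
      rw [← hRR, inner_add_right, map_add] at h1
      linarith
    have hsq : ‖(g : Hm)‖ ^ 2 ≤ ‖ιm g‖ ^ 2 := by
      rw [← Ψ.norm_map, ← inner_self_eq_norm_sq (𝕜 := ℂ), ← hinner,
        ← inner_self_eq_norm_sq (𝕜 := ℂ) (ιm g), ← huv]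
      have hRS : R u = S u + L u := by rw [← hUL u hu]; abel
      nth_rw 2 [hRS]
      rw [inner_add_left, map_add]
      linarith
    exact le_of_sq_le_sq hsq (norm_nonneg _)
  refine ⟨⟨hrange, hmbound⟩, ⟨?_, fun f hfU => ?_⟩, ?_⟩
  · refine Submodule.le_closure_of_inner_eq_zero (K := U ⊓ LinearMap.range ιp.toFun) hU inf_le_left
      fun x hx h => hSinj x ?_
    obtain ⟨f, -, hf⟩ := hp (S x)
    have h' := h (S (S x)) ⟨hSU _ (hSU x hx), f, hf⟩
    rw [← inner_self_eq_zero (𝕜 := ℂ), ← h']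
    exact ((ContinuousLinearMap.isSelfAdjoint_iff_isSymmetric.1 hS) (S x) x).symm
  · obtain ⟨g, hg : ιm g = ιp f⟩ := hrange hfU
    have hgf : ‖(g : Hm)‖ ≤ ‖ιp f‖ := hg ▸ hmbound g (hg ▸ hfU)
    have hsq : ‖ιp f‖ * ‖ιp f‖ ≤ ‖(f : Hp)‖ * ‖ιp f‖ := by
      calc ‖ιp f‖ * ‖ιp f‖ = RCLike.re ⟪ιp f, ιm g⟫_ℂ := by
            rw [hg, inner_self_eq_norm_mul_norm]
        _ ≤ ‖(f : Hp)‖ * ‖Ψ (g : Hm)‖ := by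
            rw [compat]
            exact re_inner_le_norm _ _
        _ ≤ ‖(f : Hp)‖ * ‖ιp f‖ := by
            rw [Ψ.norm_map]
            gcongr
    rcases (norm_nonneg (ιp f)).eq_or_lt with h0 | h0
    · rw [← h0]
      exact norm_nonneg _
    · exact le_of_mul_le_mul_right hsq h0
  · refine Submodule.orthogonal_topologicalClosure_eq ?_ ?_
    · rw [Submodule.isOrtho_iff_inner_eq]
      rintro _ ⟨f, ⟨hfU, -⟩, rfl⟩ _ ⟨f', hf', rfl⟩
      obtain ⟨u, hu, huf⟩ := hSsurj _ hf'
      obtain ⟨k, hkA, hk⟩ := hp u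
      obtain ⟨g, hgA, hg⟩ := hm u
      have hfk : (f' : Hp) = k := hpInj _ _ (by rw [hk, huf]; rfl)
      change ⟪(f : Hp), (f' : Hp)⟫_ℂ = 0
      rw [hfk, hkA, ← hgA, ← compat, hg]
      exact Submodule.inner_right_of_mem_orthogonal hfU (hRU' u hu)
    · rw [eq_bot_iff]
      rintro x ⟨hx, hx'⟩
      refine hA x fun y => ?_
      have : CompleteSpace U := hU.completeSpace_coe
      have hyU := U.starProjection_apply_mem y
      have hyU' : y - U.starProjection y ∈ Uᗮ := Submodule.sub_starProjection_mem_orthogonal y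
      obtain ⟨f, hfA, hf⟩ := hp (U.starProjection y)
      obtain ⟨f', hfA', hf'⟩ := hp (y - U.starProjection y)
      have hfU : f ∈ Submodule.comap ιp.toFun (U ⊓ LinearMap.range ιp.toFun) :=
        ⟨show ιp f ∈ U from hf ▸ hSU _ hyU, LinearMap.mem_range_self _ f⟩
      have hfU' : f' ∈ Submodule.comap ιp.toFun Uᗮ :=
        show ιp f' ∈ Uᗮ from hf' ▸ hSU' _ hyU'
      have h1 : ⟪x, (f : Hp)⟫_ℂ = 0 :=
        Submodule.inner_left_of_mem_orthogonal (Submodule.mem_map_of_mem hfU) hx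
      have h2 : ⟪x, (f' : Hp)⟫_ℂ = 0 :=
        Submodule.inner_left_of_mem_orthogonal (Submodule.mem_map_of_mem hfU') hx'
      rw [← add_sub_cancel (U.starProjection y) y, map_add, ← hfA, ← hfA', inner_add_right, h1, h2,
        add_zero]

end GelfandTriple

/-- Every quasi Gelfand triple `(H₊, H₀, H₋)` of Hilbert spaces decomposes into
two ordinary Gelfand triples, composed cross-wise: there are closed subspaces `V`, `W = Vᗮ` of
`H₀` such that (a) `W ⊆ ran ι₊` with `‖ι₊⁻¹ w‖₊ ≤ ‖w‖₀` on `W`; (b) `V ∩ ran ι₊` is dense in `V`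
and `‖ι₊ f‖₀ ≤ ‖f‖₊` whenever `ι₊ f ∈ V`; (c) `V ⊆ ran ι₋` with `‖ι₋⁻¹ v‖₋ ≤ ‖v‖₀` on `V`;
(d) `W ∩ ran ι₋` is dense in `W` and `‖ι₋ g‖₀ ≤ ‖g‖₋` whenever `ι₋ g ∈ W`; and (e) `H₊` is the
orthogonal direct sum of the closures of `ι₊⁻¹(V ∩ ran ι₊)` and `ι₊⁻¹ W`, while `H₋` is the
orthogonal direct sum of the closures of `ι₋⁻¹(W ∩ ran ι₋)` and `ι₋⁻¹ V`. -/
theorem stmt17 {Hp H0 Hm : Type*}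
    [NormedAddCommGroup Hp] [InnerProductSpace ℂ Hp] [CompleteSpace Hp]
    [NormedAddCommGroup H0] [InnerProductSpace ℂ H0] [CompleteSpace H0]
    [NormedAddCommGroup Hm] [InnerProductSpace ℂ Hm] [CompleteSpace Hm]
    (Ψ : Hm ≃ₗᵢ[ℂ] Hp)
    (ιp : Hp →ₗ.[ℂ] H0) (ιm : Hm →ₗ.[ℂ] H0)
    (hpDense : Dense (ιp.domain : Set Hp))
    (hmDense : Dense (ιm.domain : Set Hm))
    (hpClosed : ιp.IsClosed) (hmClosed : ιm.IsClosed)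
    (hpInj : ∀ x y : ιp.domain, ιp x = ιp y → (x : Hp) = (y : Hp))
    (hmInj : ∀ x y : ιm.domain, ιm x = ιm y → (x : Hm) = (y : Hm))
    (hpRan : Dense (Set.range fun f : ιp.domain => ιp f))
    (hmRan : Dense (Set.range fun g : ιm.domain => ιm g))
    (compat : ∀ (f : ιp.domain) (g : ιm.domain),
      (⟪ιp f, ιm g⟫_ℂ) = ⟪(f : Hp), Ψ (g : Hm)⟫_ℂ)
    (hquasi : ((ιp†).domain : Set H0) = Set.range fun g : ιm.domain => ιm g) :
    ∃ V W : Submodule ℂ H0, IsClosed (V : Set H0) ∧ W = Vᗮ ∧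
      -- (a)
      ((W : Set H0) ⊆ Set.range (fun f : ιp.domain => ιp f) ∧
        ∀ f : ιp.domain, ιp f ∈ W → ‖(f : Hp)‖ ≤ ‖ιp f‖) ∧
      -- (b)
      ((V : Set H0) ⊆ closure ((V : Set H0) ∩ Set.range (fun f : ιp.domain => ιp f)) ∧
        ∀ f : ιp.domain, ιp f ∈ V → ‖ιp f‖ ≤ ‖(f : Hp)‖) ∧
      -- (c)
      ((V : Set H0) ⊆ Set.range (fun g : ιm.domain => ιm g) ∧
        ∀ g : ιm.domain, ιm g ∈ V → ‖(g : Hm)‖ ≤ ‖ιm g‖) ∧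
      -- (d)
      ((W : Set H0) ⊆ closure ((W : Set H0) ∩ Set.range (fun g : ιm.domain => ιm g)) ∧
        ∀ g : ιm.domain, ιm g ∈ W → ‖ιm g‖ ≤ ‖(g : Hm)‖) ∧
      -- (e)
      (((Submodule.comap ιp.toFun (V ⊓ LinearMap.range ιp.toFun)).map
          ιp.domain.subtype).topologicalClosureᗮ =
        ((Submodule.comap ιp.toFun W).map ιp.domain.subtype).topologicalClosure ∧
      ((Submodule.comap ιm.toFun (W ⊓ LinearMap.range ιm.toFun)).map
          ιm.domain.subtype).topologicalClosureᗮ =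
        ((Submodule.comap ιm.toFun V).map ιm.domain.subtype).topologicalClosure) := by
  obtain ⟨A, S, hS, hp, hAS, hA⟩ := hpClosed.exists_graph_projection_blocks hpDense hpInj
  have hm (y : H0) : ∃ g : ιm.domain, Ψ (g : Hm) = A y ∧ ιm g = (1 - S) y := by
    have hy : (1 - S) y ∈ (ιp†.domain : Set H0) :=
      LinearPMap.mem_adjoint_domain_of_exists _ ⟨A y, hAS y⟩
    rw [hquasi] at hy
    obtain ⟨g, hg⟩ := hy
    refine ⟨g, hpDense.eq_of_inner_right ℂ fun v hv => ?_, hg⟩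
    rw [← compat ⟨v, hv⟩, show ιm g = y - S y from hg, ← inner_conj_symm, ← hAS y, inner_conj_symm]
  have hR : IsSelfAdjoint (1 - S) := (IsSelfAdjoint.one _).sub hS
  obtain ⟨V, L, hV, hL, hLV, hDV, hDV'⟩ := (hR.sub hS).exists_spectral_splitting
  have hLV' (x) (hx : x ∈ Vᗮ) : L x ∈ Vᗮ := hL.apply_mem_orthogonal hLV hx
  have : CompleteSpace V := hV.completeSpace_coe
  have hVV : Vᗮᗮ = V := V.orthogonal_orthogonal
  obtain ⟨hc, hb, he⟩ := reducing_subspace_properties hpInj hmInj compat hS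
    (add_sub_cancel S 1) hp hm hA hV hL hLV hDV hDV'
  obtain ⟨ha, hd, he'⟩ := reducing_subspace_properties (Ψ := Ψ.symm) (ιp := ιm) (ιm := ιp)
    (A := Ψ.symm.toContinuousLinearEquiv.toContinuousLinearMap ∘L A) (U := Vᗮ) hmInj hpInj
    (fun g f => by
      rw [← inner_conj_symm, compat, inner_conj_symm, ← Ψ.inner_map_map, Ψ.apply_symm_apply])
    hR (sub_add_cancel 1 S)
    (fun y => (hm y).imp fun g hg => ⟨(Ψ.symm_apply_eq.2 hg.1.symm).symm, hg.2⟩)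
    (fun y => (hp y).imp fun f hf => ⟨congrArg Ψ.symm hf.1, hf.2⟩)
    (fun x hx => Ψ.map_eq_zero_iff.1 <| hA _ fun y => by
      rw [← hx y, ← Ψ.inner_map_map x]
      exact congrArg _ (Ψ.apply_symm_apply _).symm)
    V.isClosed_orthogonal hL hLV' (fun x hx => by
      rw [← neg_neg (L x), ← hDV' x hx]
      exact (neg_sub _ _).symm)
    (fun x hx => by
      rw [← hDV x (hVV ▸ hx)]
      exact (neg_sub _ _).symm)
  rw [hVV] at he'
  exact ⟨V, Vᗮ, hV, rfl, ha, hb, hc, hd, he, he'⟩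
end

section
/- Let (xₙ)ₙ be a sequence in a complex Hilbert space H converging weakly to x ∈ H. Then there exists a strictly increasing map n : ℕ → ℕ such that the Cesàro means of the corresponding subsequence converge in norm to x, i.e., ‖(1/N) · Σ_{k=1}^{N} x_{n(k)} − x‖ → 0 as N → ∞. -/
open Filter Topology
open scoped InnerProductSpace

section

variable {H : Type*} [NormedAddCommGroup H] [InnerProductSpace ℂ H]

theorem exists_norm_le_of_tendsto_inner [CompleteSpace H] {x : ℕ → H} {x₀ : H}
    (hw : ∀ y : H, Tendsto (fun k => ⟪y, x k⟫_ℂ) atTop (𝓝 ⟪y, x₀⟫_ℂ)) :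
    ∃ C, ∀ k, ‖x k‖ ≤ C := by
  obtain ⟨C, hC⟩ := banach_steinhaus (g := fun k => innerSL ℂ (x k)) fun y => by
    obtain ⟨C, hC⟩ := (hw y).norm.bddAbove_range
    refine ⟨C, fun k => ?_⟩
    rw [innerSL_apply_apply, norm_inner_symm]
    exact hC ⟨k, rfl⟩
  exact ⟨C, fun k => by simpa using hC k⟩

/-- A sequence tending weakly to zero has an almost orthogonal subsequence. -/
theorem exists_strictMono_norm_inner_le {u : ℕ → H}
    (hu : ∀ y : H, Tendsto (fun k => ⟪y, u k⟫_ℂ) atTop (𝓝 0)) :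
    ∃ n : ℕ → ℕ, StrictMono n ∧
      ∀ i j, i < j → ‖⟪u (n i), u (n j)⟫_ℂ‖ ≤ (1 / 2 : ℝ) ^ i := by
  obtain ⟨n, -, hn⟩ := exists_seq_of_forall_finset_exists (fun _ : ℕ => True)
    (fun a b => a < b ∧ ‖⟪u a, u b⟫_ℂ‖ ≤ (1 / 2 : ℝ) ^ a) fun s _ => by
      have key : ∀ᶠ b in atTop, ∀ a ∈ s, a < b ∧ ‖⟪u a, u b⟫_ℂ‖ ≤ (1 / 2 : ℝ) ^ a := by
        refine (Filter.eventually_all_finset s).2 fun a _ => (eventually_gt_atTop a).and ?_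
        have h := (hu (u a)).norm
        rw [norm_zero] at h
        exact h.eventually_le_const (by positivity)
      obtain ⟨b, hb⟩ := key.exists
      exact ⟨b, trivial, hb⟩
  have hmono : StrictMono n := fun i j hij => (hn i j hij).1
  exact ⟨n, hmono, fun i j hij => (hn i j hij).2.trans
    (pow_le_pow_of_le_one (by norm_num) (by norm_num) hmono.le_apply)⟩

theorem norm_sum_Icc_sq_le_of_norm_inner_le {v : ℕ → H} {C : ℝ} (hC : ∀ k, ‖v k‖ ≤ C)
    (hv : ∀ i j, i < j → ‖⟪v i, v j⟫_ℂ‖ ≤ (1 / 2 : ℝ) ^ i) (N : ℕ) :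
    ‖∑ k ∈ Finset.Icc 1 N, v k‖ ^ 2 ≤ N * (C ^ 2 + 4) := by
  induction N with
  | zero => simp
  | succ N ih =>
    rw [Finset.sum_Icc_succ_top (by lia), norm_add_sq (𝕜 := ℂ)]
    have hinner : ‖⟪∑ k ∈ Finset.Icc 1 N, v k, v (N + 1)⟫_ℂ‖ ≤ 2 := by
      rw [sum_inner]
      calc _ ≤ ∑ k ∈ Finset.Icc 1 N, (1 / 2 : ℝ) ^ k :=
            norm_sum_le_of_le _ fun k hk => hv k _ (by grind)
        _ ≤ ∑' k, (1 / 2 : ℝ) ^ k :=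
            summable_geometric_two.sum_le_tsum _ fun k _ => by positivity
        _ = 2 := tsum_geometric_two
    have hre := (RCLike.re_le_norm ⟪∑ k ∈ Finset.Icc 1 N, v k, v (N + 1)⟫_ℂ).trans hinner
    have hsq : ‖v (N + 1)‖ ^ 2 ≤ C ^ 2 := pow_le_pow_left₀ (norm_nonneg _) (hC _) 2
    push_cast
    linarith

theorem tendsto_norm_inv_smul_of_norm_sq_le {E : Type*} [SeminormedAddCommGroup E]
    [NormedSpace ℝ E] {s : ℕ → E} {K : ℝ} (hs : ∀ N : ℕ, ‖s N‖ ^ 2 ≤ N * K) :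
    Tendsto (fun N : ℕ => ‖(N : ℝ)⁻¹ • s N‖) atTop (𝓝 0) := by
  have hlim : Tendsto (fun N : ℕ => √(K / N)) atTop (𝓝 0) := by
    simpa using (tendsto_const_div_atTop_nhds_zero_nat K).sqrt
  refine squeeze_zero' (.of_forall fun _ => norm_nonneg _) ?_ hlim
  filter_upwards [eventually_gt_atTop 0] with N hN
  have hN' : (0 : ℝ) < N := by exact_mod_cast hN
  apply Real.le_sqrt_of_sq_le
  rw [norm_smul, mul_pow, norm_inv, Real.norm_natCast]
  calc ((N : ℝ)⁻¹) ^ 2 * ‖s N‖ ^ 2 ≤ ((N : ℝ)⁻¹) ^ 2 * (N * K) := by gcongr; exact hs N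
    _ = K / N := by field_simp

end

/-- If a sequence `(xₙ)` in a complex Hilbert space converges weakly to `x`
(i.e. `⟨xₙ, y⟩ → ⟨x, y⟩` for every `y`), then there is a strictly increasing `n : ℕ → ℕ` such
that the Cesàro means `(1/N) Σ_{k=1}^{N} x_{n(k)}` converge to `x` in norm. -/
theorem stmt18 {H : Type*} [NormedAddCommGroup H] [InnerProductSpace ℂ H] [CompleteSpace H]
    (x : ℕ → H) (x₀ : H)
    (hw : ∀ y : H, Tendsto (fun k => (⟪y, x k⟫_ℂ)) atTop (𝓝 (⟪y, x₀⟫_ℂ))) :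
    ∃ n : ℕ → ℕ, StrictMono n ∧
      Tendsto (fun N : ℕ => ‖(N : ℝ)⁻¹ • (∑ k ∈ Finset.Icc 1 N, x (n k)) - x₀‖)
        atTop (𝓝 0) := by
  have hu : ∀ y : H, Tendsto (fun k => ⟪y, x k - x₀⟫_ℂ) atTop (𝓝 0) := fun y => by
    simpa [inner_sub_right] using (hw y).sub_const ⟪y, x₀⟫_ℂ
  obtain ⟨C, hC⟩ := exists_norm_le_of_tendsto_inner (x := fun k => x k - x₀) (x₀ := 0)
    fun y => by simpa using hu y
  obtain ⟨n, hn, hinner⟩ := exists_strictMono_norm_inner_le hu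
  refine ⟨n, hn, (tendsto_norm_inv_smul_of_norm_sq_le
    (norm_sum_Icc_sq_le_of_norm_inner_le (fun k => hC (n k)) hinner)).congr' ?_⟩
  filter_upwards [eventually_gt_atTop 0] with N hN
  have hN' : (N : ℝ) ≠ 0 := by exact_mod_cast hN.ne'
  rw [Finset.sum_sub_distrib, Finset.sum_const, Nat.card_Icc, Nat.add_sub_cancel,
    ← Nat.cast_smul_eq_nsmul ℝ, smul_sub, inv_smul_smul₀ hN']
end
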